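/- arXiv:2211.12582 — 4 statements merged into one kernel-verified Lean document; each statement's English description precedes it below -/
import Mathlib

section
/- Let d be a positive integer and let G be a graph on d+2 vertices that is not complete multipartite. Let A_G be the adjacency matrix of G with eigenvalues λ₁ ≥ λ₂ ≥ … ≥ λ_{d+2}, let J be the (d+2)×(d+2) all-ones matrix, and let P = I − J/(d+2) be the orthogonal projection onto 𝟙^⊥. Let m be the multiplicity of λ₂ as an eigenvalue of A_G, diminished by one if λ₁ = λ₂. Then G has a spherical representation in ℝ^d if and only if the maximum eigenvalue of P·A_G·P restricted to the subspace 𝟙^⊥ equals λ₂ and the multiplicity of λ₂ as an eigenvalue of P·A_G·P restricted to 𝟙^⊥ equals m. -/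
open Matrix Finset
open scoped Classical

noncomputable section

/-- `p` realizes the graph `G` as a 2-distance set in `ℝ^d` with distance ratio `k`:
the larger distance `α₁` occurs exactly between adjacent vertices, the smaller
distance `α₂` between distinct non-adjacent vertices, both distances occur,
and `k = α₁ / α₂`. -/
def IsTwoDistRep (n d : ℕ) (G : SimpleGraph (Fin n)) (k : ℝ)
    (p : Fin n → EuclideanSpace ℝ (Fin d)) : Prop :=
  ∃ α₁ α₂ : ℝ, α₂ < α₁ ∧ 0 < α₂ ∧ k = α₁ / α₂ ∧
    (∀ i j : Fin n, G.Adj i j → dist (p i) (p j) = α₁) ∧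
    (∀ i j : Fin n, i ≠ j → ¬ G.Adj i j → dist (p i) (p j) = α₂) ∧
    (∃ i j : Fin n, G.Adj i j) ∧ (∃ i j : Fin n, i ≠ j ∧ ¬ G.Adj i j)

/-- `G` (a graph on `n` vertices) is representable in `ℝ^d` with ratio `k`. -/
def RepresentableWith (n d : ℕ) (G : SimpleGraph (Fin n)) (k : ℝ) : Prop :=
  ∃ p : Fin n → EuclideanSpace ℝ (Fin d), IsTwoDistRep n d G k p

/-- `G` has a spherical representation in `ℝ^d` with ratio `k`. -/
def SphericalWith (n d : ℕ) (G : SimpleGraph (Fin n)) (k : ℝ) : Prop :=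
  ∃ (p : Fin n → EuclideanSpace ℝ (Fin d)) (c : EuclideanSpace ℝ (Fin d)) (r : ℝ),
    IsTwoDistRep n d G k p ∧ ∀ i, dist (p i) c = r

/-- `G` has a spherical representation in `ℝ^d` (for some ratio). -/
def Spherical (n d : ℕ) (G : SimpleGraph (Fin n)) : Prop :=
  ∃ k : ℝ, SphericalWith n d G k

/-- `G` is a complete multipartite graph: vertices can be classified so that two
vertices are adjacent exactly when they lie in different classes. -/
def IsCompleteMultipartite {n : ℕ} (G : SimpleGraph (Fin n)) : Prop :=
  ∃ f : Fin n → Fin n, ∀ i j : Fin n, G.Adj i j ↔ f i ≠ f j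

/-- The matrix `B_G(k)`: zero diagonal, `-k²` at adjacent pairs, `-1` at
distinct non-adjacent pairs. -/
def BG {n : ℕ} (G : SimpleGraph (Fin n)) [DecidableRel G.Adj] (k : ℝ) :
    Matrix (Fin n) (Fin n) ℝ :=
  Matrix.of fun i j => if i = j then 0 else if G.Adj i j then -k ^ 2 else -1

/-- The all-ones matrix `J`. -/
def Jmat (n : ℕ) : Matrix (Fin n) (Fin n) ℝ := Matrix.of fun _ _ => 1

/-- The orthogonal complement `𝟙^⊥` of the all-ones vector in `ℝ^n`. -/
def onePerp (n : ℕ) : Submodule ℝ (Fin n → ℝ) :=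
  LinearMap.ker ((∑ i : Fin n, LinearMap.proj i : (Fin n → ℝ) →ₗ[ℝ] ℝ))

end
section
variable {n : ℕ}

theorem eig_data (M : Matrix (Fin n) (Fin n) ℝ) (hM : M.IsHermitian) :
    ∃ f : Fin n → (Fin n → ℝ), (∀ i j, f i ⬝ᵥ f j = if i = j then 1 else 0) ∧
      (∀ i, M *ᵥ f i = hM.eigenvalues i • f i) ∧
      (∀ v : Fin n → ℝ, v = ∑ i, (f i ⬝ᵥ v) • f i) := by
  refine ⟨fun i => (hM.eigenvectorBasis i).ofLp, ?_, ?_, ?_⟩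
  · intro i j
    have h := orthonormal_iff_ite.mp hM.eigenvectorBasis.orthonormal i j
    rw [EuclideanSpace.inner_eq_star_dotProduct] at h
    rw [dotProduct_comm]; simpa using h
  · intro i; exact hM.mulVec_eigenvectorBasis i
  · intro v
    have h := hM.eigenvectorBasis.sum_repr' (WithLp.toLp 2 v)
    have h2 := congrArg WithLp.ofLp h
    simp only [EuclideanSpace.inner_eq_star_dotProduct] at h2
    simp only [WithLp.ofLp_sum, WithLp.ofLp_smul] at h2
    refine h2.symm.trans (Finset.sum_congr rfl fun i _ => ?_)
    rw [dotProduct_comm]; simp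

theorem parseval (f : Fin n → (Fin n → ℝ))
    (hv : ∀ v : Fin n → ℝ, v = ∑ i, (f i ⬝ᵥ v) • f i) (v w : Fin n → ℝ) :
    v ⬝ᵥ w = ∑ i, (f i ⬝ᵥ v) * (f i ⬝ᵥ w) := by
  conv_lhs => rw [hv v]
  rw [sum_dotProduct]
  simp

theorem symm_dot (M : Matrix (Fin n) (Fin n) ℝ) (hM : M.IsHermitian) (v w : Fin n → ℝ) :
    v ⬝ᵥ (M *ᵥ w) = w ⬝ᵥ (M *ᵥ v) := by
  have : Mᵀ = M := by simpa [IsHermitian, conjTranspose_eq_transpose_of_trivial] using hM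
  rw [dotProduct_mulVec, ← mulVec_transpose, this, dotProduct_comm]

theorem quad_eq (M : Matrix (Fin n) (Fin n) ℝ) (hM : M.IsHermitian) (f : Fin n → (Fin n → ℝ))
    (η : Fin n → ℝ) (hf : ∀ i, M *ᵥ f i = η i • f i)
    (hv : ∀ v : Fin n → ℝ, v = ∑ i, (f i ⬝ᵥ v) • f i) (v : Fin n → ℝ) :
    v ⬝ᵥ (M *ᵥ v) = ∑ i, η i * (f i ⬝ᵥ v)^2 := by
  rw [parseval f hv]
  refine Finset.sum_congr rfl fun i _ => ?_
  rw [symm_dot M hM (f i) v, hf, dotProduct_smul, dotProduct_comm v, smul_eq_mul]; ring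

theorem finrank_eigen (M : Matrix (Fin n) (Fin n) ℝ) (hM : M.IsHermitian)
    (f : Fin n → (Fin n → ℝ)) (η : Fin n → ℝ)
    (hon : ∀ i j, f i ⬝ᵥ f j = if i = j then 1 else 0)
    (hf : ∀ i, M *ᵥ f i = η i • f i)
    (hv : ∀ v : Fin n → ℝ, v = ∑ i, (f i ⬝ᵥ v) • f i) (c : ℝ) :
    Module.finrank ℝ ↥(Module.End.eigenspace M.mulVecLin c) =
      (Finset.univ.filter fun i => η i = c).card := by
  have hli : LinearIndependent ℝ (fun i : {i // η i = c} => f i) := by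
    refine LinearIndependent.comp (v := f) ?_ (fun i : {i // η i = c} => (i:Fin n))
      Subtype.val_injective
    rw [Fintype.linearIndependent_iff]
    intro g hg i
    have := congrArg (fun x => f i ⬝ᵥ x) hg
    simpa [dotProduct_sum, hon] using this
  have hspan : Module.End.eigenspace M.mulVecLin c =
      Submodule.span ℝ (Set.range (fun i : {i // η i = c} => f i)) := by
    apply le_antisymm
    · intro v h
      rw [Module.End.mem_eigenspace_iff, mulVecLin_apply] at h
      rw [hv v]
      refine Submodule.sum_mem _ fun i _ => ?_
      by_cases hi : η i = c
      · exact Submodule.smul_mem _ _ (Submodule.subset_span ⟨⟨i, hi⟩, rfl⟩)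
      · have h1 := symm_dot M hM (f i) v
        rw [h, hf, dotProduct_smul, dotProduct_smul, dotProduct_comm v, smul_eq_mul, smul_eq_mul] at h1
        have : f i ⬝ᵥ v = 0 := by
          by_contra h0
          exact hi (mul_right_cancel₀ h0 h1).symm
        rw [this, zero_smul]; exact Submodule.zero_mem _
    · rw [Submodule.span_le]
      rintro _ ⟨⟨i, hi⟩, rfl⟩
      simp only [SetLike.mem_coe, Module.End.mem_eigenspace_iff, mulVecLin_apply]
      rw [hf, hi]
  rw [hspan, finrank_span_eq_card hli, Fintype.card_subtype]

theorem dot_self_pos' {v : Fin n → ℝ} (h : v ≠ 0) : 0 < v ⬝ᵥ v := by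
  have h0 : 0 ≤ v ⬝ᵥ v := Finset.sum_nonneg fun i _ => mul_self_nonneg _
  exact lt_of_le_of_ne h0 (fun e => h (dotProduct_self_eq_zero.mp e.symm))

/-- psd on whole: zero of the form is in the kernel, relative to a subspace version -/
theorem psd_kernel (Q : Matrix (Fin n) (Fin n) ℝ) (hQ : Q.IsHermitian) (S : Submodule ℝ (Fin n → ℝ))
    (hpos : ∀ w ∈ S, 0 ≤ w ⬝ᵥ (Q *ᵥ w)) (v : Fin n → ℝ) (hvS : v ∈ S)
    (h0 : v ⬝ᵥ (Q *ᵥ v) = 0) (y : Fin n → ℝ) (hy : y ∈ S) : y ⬝ᵥ (Q *ᵥ v) = 0 := by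
  have key : ∀ t : ℝ, 0 ≤ 0 * (t * t) + (2 * (y ⬝ᵥ (Q *ᵥ v))) * t + y ⬝ᵥ (Q *ᵥ y) := by
    intro t
    have := hpos (y + t • v) (S.add_mem hy (S.smul_mem _ hvS))
    simp only [mulVec_add, mulVec_smul, dotProduct_add, add_dotProduct, smul_dotProduct,
      dotProduct_smul, smul_eq_mul, h0, symm_dot Q hQ v y] at this
    linarith
  have := discrim_le_zero key
  simp only [discrim] at this
  nlinarith [sq_nonneg (y ⬝ᵥ (Q *ᵥ v))]

theorem mem_onePerp (v : Fin n → ℝ) : v ∈ onePerp n ↔ ∑ i, v i = 0 := by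
  simp [onePerp, LinearMap.mem_ker]

theorem one_mem_range (Q : Matrix (Fin n) (Fin n) ℝ) (hQ : Q.IsHermitian)
    (b : Fin n → ℝ) (hb : ∀ v, Q *ᵥ v = 0 → v ⬝ᵥ b = 0) : ∃ u, Q *ᵥ u = b := by
  obtain ⟨f, hon, hf, hv⟩ := eig_data Q hQ
  refine ⟨∑ i, ((f i ⬝ᵥ b) / hQ.eigenvalues i) • f i, ?_⟩
  conv_rhs => rw [hv b]
  rw [mulVec_sum]
  refine Finset.sum_congr rfl fun i _ => ?_
  rw [mulVec_smul, hf, smul_smul]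
  by_cases h : hQ.eigenvalues i = 0
  · rw [hb (f i) (by rw [hf, h, zero_smul])]; simp
  · rw [div_mul_cancel₀ _ h]

/-- Gram representation. -/
theorem gram_rep {d : ℕ} (M : Matrix (Fin n) (Fin n) ℝ) (hM : M.IsHermitian)
    (hpos : ∀ w, 0 ≤ w ⬝ᵥ (M *ᵥ w))
    (hcard : (Finset.univ.filter fun i => hM.eigenvalues i ≠ 0).card ≤ d) :
    ∃ q : Fin n → EuclideanSpace ℝ (Fin d), ∀ i j, inner ℝ (q i) (q j) = M i j := by
  obtain ⟨f, hon, hf, hv⟩ := eig_data M hM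
  have hη : ∀ i, 0 ≤ hM.eigenvalues i := fun i => by
    have := hpos (f i)
    rw [hf, dotProduct_smul, hon] at this
    simpa using this
  have : ∃ g : {i // hM.eigenvalues i ≠ 0} → Fin d, Function.Injective g := by
    have : Fintype.card {i // hM.eigenvalues i ≠ 0} ≤ Fintype.card (Fin d) := by
      rw [Fintype.card_subtype, Fintype.card_fin]; exact hcard
    obtain ⟨g⟩ := Function.Embedding.nonempty_of_card_le this
    exact ⟨g, g.injective⟩
  obtain ⟨g, hg⟩ := this
  refine ⟨fun i => ∑ k : {i // hM.eigenvalues i ≠ 0},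
    (√(hM.eigenvalues k) * f k i) • EuclideanSpace.single (g k) (1:ℝ), fun i j => ?_⟩
  have h1 : M i j = ∑ k, hM.eigenvalues k * (f k i * f k j) := by
    have e : M i j = Pi.single i 1 ⬝ᵥ (M *ᵥ Pi.single j 1) := by simp
    rw [e, parseval f hv]
    refine Finset.sum_congr rfl fun k _ => ?_
    rw [symm_dot M hM (f k), hf]
    simp; ring
  rw [h1, sum_inner]
  simp only [inner_sum, inner_smul_left, inner_smul_right]
  have : ∀ k l, inner ℝ (EuclideanSpace.single (g k) (1:ℝ)) (EuclideanSpace.single (g l) (1:ℝ))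
      = if k = l then (1:ℝ) else 0 := by
    intro k l
    by_cases h : k = l
    · subst h; simp
    · have : g k ≠ g l := fun e => h (hg e)
      rw [EuclideanSpace.inner_single_left]; simp [h, this]
  simp only [this]
  simp only [mul_ite, mul_one, mul_zero, Finset.sum_ite_eq, Finset.mem_univ, if_true]
  have h2 : ∑ k, hM.eigenvalues k * (f k i * f k j) =
      ∑ k ∈ Finset.univ.filter (fun k => hM.eigenvalues k ≠ 0),
        hM.eigenvalues k * (f k i * f k j) := by
    rw [Finset.sum_filter]
    refine Finset.sum_congr rfl fun k _ => ?_
    by_cases h : hM.eigenvalues k = 0 <;> simp [h]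
  rw [h2, Finset.sum_subtype (p := fun k => hM.eigenvalues k ≠ 0) _ (by simp)]
  refine Finset.sum_congr rfl fun k _ => ?_
  have := Real.mul_self_sqrt (hη k)
  simp only [conj_trivial]
  linear_combination (f k i * f k j) * this

theorem finrank_inf_onePerp (N : Submodule ℝ (Fin n → ℝ)) (h : ¬ N ≤ onePerp n) :
    Module.finrank ℝ ↥(N ⊓ onePerp n) + 1 = Module.finrank ℝ N := by
  let φ : N →ₗ[ℝ] ℝ := (∑ i : Fin n, LinearMap.proj i : (Fin n → ℝ) →ₗ[ℝ] ℝ).comp N.subtype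
  have hφ : φ ≠ 0 := by
    intro e
    apply h
    intro x hx
    have := LinearMap.congr_fun e ⟨x, hx⟩
    rw [onePerp, LinearMap.mem_ker]
    exact this
  have h1 := LinearMap.finrank_range_add_finrank_ker φ
  rw [LinearMap.range_eq_top.mpr (LinearMap.surjective hφ), finrank_top, Module.finrank_self] at h1
  have h2 : LinearMap.ker φ = (onePerp n).comap N.subtype := by
    rw [onePerp]; rfl
  rw [← Submodule.map_comap_subtype, ← h2, Submodule.finrank_map_subtype_eq]
  omega

/-- bound on the quadratic form by the largest eigenvalue -/
theorem quad_le (M : Matrix (Fin n) (Fin n) ℝ) (hM : M.IsHermitian) (f : Fin n → (Fin n → ℝ))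
    (η : Fin n → ℝ) (hf : ∀ i, M *ᵥ f i = η i • f i)
    (hv : ∀ v : Fin n → ℝ, v = ∑ i, (f i ⬝ᵥ v) • f i) (c : ℝ) (v : Fin n → ℝ)
    (hc : ∀ i, f i ⬝ᵥ v = 0 ∨ η i ≤ c) :
    v ⬝ᵥ (M *ᵥ v) ≤ c * (v ⬝ᵥ v) := by
  rw [quad_eq M hM f η hf hv, parseval f hv v v, Finset.mul_sum]
  refine Finset.sum_le_sum fun i _ => ?_
  rcases hc i with h | h
  · rw [h]; simp
  · nlinarith [mul_self_nonneg (f i ⬝ᵥ v)]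

theorem dot_sub_form (M : Matrix (Fin n) (Fin n) ℝ) (c : ℝ) (v w : Fin n → ℝ) :
    v ⬝ᵥ ((c • (1 : Matrix (Fin n) (Fin n) ℝ) - M) *ᵥ w) = c * (v ⬝ᵥ w) - v ⬝ᵥ (M *ᵥ w) := by
  rw [sub_mulVec, smul_mulVec, one_mulVec, dotProduct_sub, dotProduct_smul, smul_eq_mul]

theorem herm_sub (M : Matrix (Fin n) (Fin n) ℝ) (hM : M.IsHermitian) (c : ℝ) :
    (c • (1 : Matrix (Fin n) (Fin n) ℝ) - M).IsHermitian := by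
  apply IsHermitian.sub _ hM
  ext i j
  simp [Matrix.one_apply, eq_comm]

theorem eq_of_dot (v w : Fin n → ℝ) (h : ∀ y, y ⬝ᵥ v = y ⬝ᵥ w) : v = w := by
  funext i
  simpa using h (Pi.single i 1)

/-- Perron-type fact: for a nonnegative symmetric matrix bounded above by `c`, an eigenvector
for `c` yields one with nonzero sum. -/
theorem perron (A : Matrix (Fin n) (Fin n) ℝ) (hA : A.IsHermitian) (hnn : ∀ i j, 0 ≤ A i j)
    (c : ℝ) (hc : ∀ v, v ⬝ᵥ (A *ᵥ v) ≤ c * (v ⬝ᵥ v)) (v : Fin n → ℝ) (hv0 : v ≠ 0)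
    (hv : A *ᵥ v = c • v) : ∃ u, A *ᵥ u = c • u ∧ ∑ i, u i ≠ 0 := by
  refine ⟨fun i => |v i|, ?_, ?_⟩
  · set u : Fin n → ℝ := fun i => |v i| with hu
    have huu : u ⬝ᵥ u = v ⬝ᵥ v := by
      simp [dotProduct, hu]
    have h1 : v ⬝ᵥ (A *ᵥ v) ≤ u ⬝ᵥ (A *ᵥ u) := by
      simp only [dotProduct, mulVec, Finset.mul_sum]
      refine Finset.sum_le_sum fun i _ => Finset.sum_le_sum fun j _ => ?_
      calc v i * (A i j * v j) ≤ |v i * (A i j * v j)| := le_abs_self _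
        _ = _ := by rw [abs_mul, abs_mul, abs_of_nonneg (hnn i j)]
    have h2 : c * (u ⬝ᵥ u) - u ⬝ᵥ (A *ᵥ u) = 0 := by
      have := hc u
      rw [hv, dotProduct_smul, smul_eq_mul] at h1
      rw [huu] at *
      linarith
    refine (eq_of_dot _ _ fun y => ?_)
    have := psd_kernel _ (herm_sub A hA c) ⊤ (fun w _ => by
      rw [dot_sub_form]; linarith [hc w]) u trivial (by rw [dot_sub_form]; exact h2) y trivial
    rw [dot_sub_form] at this
    rw [dotProduct_smul, smul_eq_mul]; linarith
  · intro h
    apply hv0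
    funext i
    have := (Finset.sum_eq_zero_iff_of_nonneg (fun i _ => abs_nonneg (v i))).mp h i (Finset.mem_univ _)
    simpa using this

end

section
variable {d : ℕ}

theorem P_mulVec (v : Fin (d+2) → ℝ) :
    ((1 : Matrix (Fin (d+2)) (Fin (d+2)) ℝ) - ((d : ℝ) + 2)⁻¹ • Jmat (d+2)) *ᵥ v
      = fun i => v i - ((d : ℝ) + 2)⁻¹ * ∑ j, v j := by
  funext i
  rw [sub_mulVec, one_mulVec, smul_mulVec]
  simp [Jmat, mulVec, dotProduct]

theorem P_mulVec_perp {v : Fin (d+2) → ℝ} (h : ∑ i, v i = 0) :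
    ((1 : Matrix (Fin (d+2)) (Fin (d+2)) ℝ) - ((d : ℝ) + 2)⁻¹ • Jmat (d+2)) *ᵥ v = v := by
  rw [P_mulVec]; simp [h]

theorem P_sum (v : Fin (d+2) → ℝ) :
    ∑ i, (((1 : Matrix (Fin (d+2)) (Fin (d+2)) ℝ) - ((d : ℝ) + 2)⁻¹ • Jmat (d+2)) *ᵥ v) i = 0 := by
  rw [P_mulVec]
  have : (d:ℝ) + 2 ≠ 0 := by positivity
  simp [Finset.sum_sub_distrib]
  field_simp; ring

theorem P_herm :
    ((1 : Matrix (Fin (d+2)) (Fin (d+2)) ℝ) - ((d : ℝ) + 2)⁻¹ • Jmat (d+2)).IsHermitian := by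
  ext i j
  simp [Jmat, Matrix.one_apply, eq_comm]

theorem PAP_herm (A P : Matrix (Fin (d+2)) (Fin (d+2)) ℝ) (hA : A.IsHermitian)
    (hP : P.IsHermitian) : (P * A * P).IsHermitian := by
  have := isHermitian_mul_mul_conjTranspose P hA
  rwa [hP.eq] at this

/-- pairing PAP on the orthogonal complement -/
theorem PAP_dot (A P : Matrix (Fin (d+2)) (Fin (d+2)) ℝ)
    (hP : P = 1 - ((d : ℝ) + 2)⁻¹ • Jmat (d+2)) (y w : Fin (d+2) → ℝ)
    (hy : ∑ i, y i = 0) (hw : ∑ i, w i = 0) :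
    y ⬝ᵥ ((P * A * P) *ᵥ w) = y ⬝ᵥ (A *ᵥ w) := by
  have h1 : P *ᵥ w = w := by rw [hP]; exact P_mulVec_perp hw
  have h2 : P *ᵥ y = y := by rw [hP]; exact P_mulVec_perp hy
  rw [← mulVec_mulVec, ← mulVec_mulVec, h1, symm_dot P (by rw [hP]; exact P_herm), h2,
    dotProduct_comm]

theorem PAP_of_eig (A P : Matrix (Fin (d+2)) (Fin (d+2)) ℝ)
    (hP : P = 1 - ((d : ℝ) + 2)⁻¹ • Jmat (d+2)) (w : Fin (d+2) → ℝ) (t : ℝ)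
    (hw : ∑ i, w i = 0) (h : A *ᵥ w = t • w) : (P * A * P) *ᵥ w = t • w := by
  have h1 : P *ᵥ w = w := by rw [hP]; exact P_mulVec_perp hw
  rw [← mulVec_mulVec, ← mulVec_mulVec, h1, h, mulVec_smul, h1]

theorem form_bound (A P : Matrix (Fin (d+2)) (Fin (d+2)) ℝ) (hA : A.IsHermitian)
    (hP : P = 1 - ((d : ℝ) + 2)⁻¹ • Jmat (d+2)) (c : ℝ)
    (hc : ∀ t : ℝ, (∃ w : Fin (d+2) → ℝ, (∑ i, w i) = 0 ∧ w ≠ 0 ∧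
          (P * A * P).mulVec w = t • w) → t ≤ c) (w : Fin (d+2) → ℝ) (hw : ∑ i, w i = 0) :
    w ⬝ᵥ (A *ᵥ w) ≤ c * (w ⬝ᵥ w) := by
  have hPh : P.IsHermitian := by rw [hP]; exact P_herm
  have hPw : P *ᵥ w = w := by rw [hP]; exact P_mulVec_perp hw
  have hPP : ∀ v, P *ᵥ (P *ᵥ v) = P *ᵥ v := by
    intro v
    have : ∑ i, (P *ᵥ v) i = 0 := by rw [hP]; exact P_sum v
    have h2 := P_mulVec_perp this
    rwa [← hP] at h2
  obtain ⟨f, hon, hf, hv⟩ := eig_data (P * A * P) (PAP_herm A P hA hPh)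
  rw [← PAP_dot A P hP w w hw hw]
  apply quad_le _ (PAP_herm A P hA hPh) f _ hf hv
  intro i
  by_cases h : P *ᵥ f i = 0
  · left
    rw [← hPw, symm_dot P hPh, h, dotProduct_zero]
  · right
    apply hc
    refine ⟨P *ᵥ f i, by rw [hP]; exact P_sum _, h, ?_⟩
    have h3 := congrArg (fun v => P *ᵥ v) (hf i)
    simp only [mulVec_smul, ← mulVec_mulVec, hPP] at h3 ⊢
    exact h3

theorem interlace (A : Matrix (Fin (d+2)) (Fin (d+2)) ℝ) (f : Fin (d+2) → (Fin (d+2) → ℝ))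
    (μ : Fin (d+2) → ℝ) (hmono : Antitone μ)
    (hon : ∀ i j, f i ⬝ᵥ f j = if i = j then 1 else 0)
    (hf : ∀ i, A *ᵥ f i = μ i • f i) (c : ℝ)
    (hb : ∀ w : Fin (d+2) → ℝ, ∑ i, w i = 0 → w ⬝ᵥ (A *ᵥ w) ≤ c * (w ⬝ᵥ w)) : μ 1 ≤ c := by
  by_cases h1 : ∑ i, f 1 i = 0
  · have := hb _ h1
    rw [hf, dotProduct_smul, hon] at this
    simpa using this
  · have h01 : μ 1 ≤ μ 0 := hmono (Fin.zero_le _)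
    set s1 := ∑ i, f 1 i
    set s0 := ∑ i, f 0 i
    have := hb (s1 • f 0 - s0 • f 1) (by
      simp only [Pi.sub_apply, Pi.smul_apply, smul_eq_mul, Finset.sum_sub_distrib, ← Finset.mul_sum]
      change s1 * s0 - s0 * s1 = 0
      ring)
    simp only [mulVec_sub, mulVec_smul, hf, dotProduct_sub, sub_dotProduct, dotProduct_smul,
      smul_dotProduct, hon, smul_eq_mul] at this
    simp at this
    have hp : 0 < s1 * s1 := mul_self_pos.mpr h1
    by_contra hlt
    push Not at hlt
    nlinarith [mul_self_nonneg s0]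

theorem finrank_m (A : Matrix (Fin (d+2)) (Fin (d+2)) ℝ) (hA : A.IsHermitian)
    (hnn : ∀ i j, 0 ≤ A i j)
    (f : Fin (d+2) → (Fin (d+2) → ℝ))
    (μ : Fin (d+2) → ℝ) (hmono : Antitone μ)
    (hon : ∀ i j, f i ⬝ᵥ f j = if i = j then 1 else 0)
    (hf : ∀ i, A *ᵥ f i = μ i • f i)
    (hv : ∀ v : Fin (d+2) → ℝ, v = ∑ i, (f i ⬝ᵥ v) • f i)
    (hb : ∀ w : Fin (d+2) → ℝ, ∑ i, w i = 0 → w ⬝ᵥ (A *ᵥ w) ≤ μ 1 * (w ⬝ᵥ w)) :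
    Module.finrank ℝ ↥(Module.End.eigenspace A.mulVecLin (μ 1) ⊓ onePerp (d+2)) =
      (Finset.univ.filter fun i => μ i = μ 1).card - (if μ 0 = μ 1 then 1 else 0) := by
  rw [← finrank_eigen A hA f μ hon hf hv]
  have hne : ∀ i, f i ≠ 0 := fun i h => by
    have := hon i i
    rw [h] at this; simp at this
  split_ifs with h
  · rw [← finrank_inf_onePerp (Module.End.eigenspace A.mulVecLin (μ 1))]
    · rfl
    · intro hle
      obtain ⟨u, hu, hs⟩ := perron A hA hnn (μ 1) (fun v =>
        quad_le A hA f μ hf hv _ v (fun i => Or.inr (h ▸ hmono (Fin.zero_le i)))) (f 1) (hne 1) (hf 1)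
      exact hs ((mem_onePerp u).mp (hle (by
        rw [Module.End.mem_eigenspace_iff]; exact hu)))
  · have hle : Module.End.eigenspace A.mulVecLin (μ 1) ≤ onePerp (d+2) := by
      intro u hu
      rw [mem_onePerp]
      rw [Module.End.mem_eigenspace_iff, mulVecLin_apply] at hu
      by_contra hs
      have hlt : μ 1 < μ 0 := lt_of_le_of_ne (hmono (Fin.zero_le _)) (Ne.symm h)
      set a := (∑ i, f 0 i) / ∑ i, u i with ha
      have hw := hb (f 0 - a • u) (by
        simp only [Pi.sub_apply, Pi.smul_apply, smul_eq_mul, Finset.sum_sub_distrib,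
          ← Finset.mul_sum, ha]
        field_simp; ring)
      have e := symm_dot A hA u (f 0)
      simp only [mulVec_sub, mulVec_smul, hf, hu, dotProduct_sub, sub_dotProduct, dotProduct_smul,
        smul_dotProduct, hon, smul_eq_mul, if_true] at hw e
      rw [dotProduct_comm (f 0) u] at hw e
      have e2 : u ⬝ᵥ f 0 = 0 := by
        have : (μ 0 - μ 1) * (u ⬝ᵥ f 0) = 0 := by linarith
        rcases mul_eq_zero.mp this with h' | h'
        · linarith
        · exact h'
      rw [e2] at hw
      linarith
    rw [inf_eq_left.mpr hle]; simp

theorem J_dot (y w : Fin (d+2) → ℝ) : y ⬝ᵥ (Jmat (d+2) *ᵥ w) = (∑ i, y i) * ∑ i, w i := by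
  simp [Jmat, mulVec, dotProduct, Finset.sum_mul]

theorem J_mulVec (w : Fin (d+2) → ℝ) : Jmat (d+2) *ᵥ w = fun _ => ∑ i, w i := by
  funext i
  simp [Jmat, mulVec, dotProduct]

theorem construct (A : Matrix (Fin (d+2)) (Fin (d+2)) ℝ) (hA : A.IsHermitian) (c : ℝ)
    (hE : ∀ w : Fin (d+2) → ℝ, ∑ i, w i = 0 →
      (∀ y : Fin (d+2) → ℝ, ∑ i, y i = 0 → y ⬝ᵥ (A *ᵥ w) = c * (y ⬝ᵥ w)) → A *ᵥ w = c • w)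
    (hb : ∀ w : Fin (d+2) → ℝ, ∑ i, w i = 0 → w ⬝ᵥ (A *ᵥ w) ≤ c * (w ⬝ᵥ w))
    (w0 : Fin (d+2) → ℝ) (hw0 : w0 ≠ 0) (hs0 : ∑ i, w0 i = 0) (hA0 : A *ᵥ w0 = c • w0) :
    ∃ (t : ℝ) (q : Fin (d+2) → EuclideanSpace ℝ (Fin d)), ∀ i j,
      inner ℝ (q i) (q j) =
        (c • (1 : Matrix (Fin (d+2)) (Fin (d+2)) ℝ) - A + t • Jmat (d+2)) i j := by
  set Q := c • (1 : Matrix (Fin (d+2)) (Fin (d+2)) ℝ) - A with hQdef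
  have hQ : Q.IsHermitian := herm_sub A hA c
  have hQv : ∀ v, Q *ᵥ v = c • v - A *ᵥ v := fun v => by
    rw [hQdef, sub_mulVec, smul_mulVec, one_mulVec]
  have hu : ∃ (u : Fin (d+2) → ℝ) (s : ℝ), Q *ᵥ u = (fun _ => s) ∧ ∑ i, u i ≠ 0 := by
    by_cases h : ∃ u, Q *ᵥ u = 0 ∧ ∑ i, u i ≠ 0
    · obtain ⟨u, h1, h2⟩ := h
      exact ⟨u, 0, h1, h2⟩
    · push Not at h
      obtain ⟨u, hu⟩ := one_mem_range Q hQ (fun _ => 1) (fun v hv => by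
        simpa [dotProduct] using h v hv)
      refine ⟨u, 1, hu, fun hs => ?_⟩
      have h1 := hE u hs (fun y hy => by
        have : y ⬝ᵥ (Q *ᵥ u) = 0 := by rw [hu]; simpa [dotProduct] using hy
        rw [dot_sub_form] at this; linarith)
      rw [hQv, h1, sub_self] at hu
      have := congrFun hu 0
      simp at this
  obtain ⟨u, s, hu, hs⟩ := hu
  set S := ∑ i, u i with hS
  have hJh : (Jmat (d+2)).IsHermitian := by
    ext i j; simp [Jmat]
  set M := Q + (-(s / S)) • Jmat (d+2) with hMdef
  have hM : M.IsHermitian := by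
    apply hQ.add
    ext i j
    simp [Jmat]
  have hMv : ∀ v, M *ᵥ v = Q *ᵥ v + (-(s / S)) • (fun _ => ∑ i, v i) := fun v => by
    rw [hMdef, add_mulVec, smul_mulVec, J_mulVec]
  have hMu : M *ᵥ u = 0 := by
    rw [hMv, hu]
    funext i
    simp only [Pi.add_apply, Pi.smul_apply, smul_eq_mul, Pi.zero_apply, ← hS]
    field_simp; ring
  have hMw : ∀ w : Fin (d+2) → ℝ, ∑ i, w i = 0 → M *ᵥ w = Q *ᵥ w := fun w hw => by
    rw [hMv, hw]; funext i; simp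
  have hpos : ∀ v, 0 ≤ v ⬝ᵥ (M *ᵥ v) := by
    intro v
    set a := (∑ i, v i) / S with ha
    have hw : ∑ i, (v - a • u) i = 0 := by
      simp only [Pi.sub_apply, Pi.smul_apply, smul_eq_mul, Finset.sum_sub_distrib,
          ← Finset.mul_sum, ha, ← hS]
      field_simp; ring
    have h1 : (v - a • u) ⬝ᵥ (M *ᵥ (v - a • u)) = v ⬝ᵥ (M *ᵥ v) := by
      have := symm_dot M hM u v
      simp only [mulVec_sub, mulVec_smul, hMu, dotProduct_sub, sub_dotProduct, smul_dotProduct,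
        this]
      simp
    rw [← h1, hMw _ hw, dot_sub_form]
    linarith [hb _ hw]
  have hN0 : w0 ∈ Module.End.eigenspace M.mulVecLin 0 := by
    rw [Module.End.mem_eigenspace_iff, mulVecLin_apply, hMw _ hs0, hQv, hA0]; simp
  have hNu : u ∈ Module.End.eigenspace M.mulVecLin 0 := by
    rw [Module.End.mem_eigenspace_iff, mulVecLin_apply, hMu]; simp
  have hr := finrank_inf_onePerp (Module.End.eigenspace M.mulVecLin 0)
    (fun hle => hs ((mem_onePerp u).mp (hle hNu)))
  have hr2 : 0 < Module.finrank ℝ ↥(Module.End.eigenspace M.mulVecLin 0 ⊓ onePerp (d+2)) := by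
    rw [Module.finrank_pos_iff_exists_ne_zero]
    exact ⟨⟨w0, hN0, (mem_onePerp w0).mpr hs0⟩, fun h => hw0 (congrArg Subtype.val h)⟩
  obtain ⟨f, hon, hf, hv⟩ := eig_data M hM
  rw [finrank_eigen M hM f _ hon hf hv] at hr
  have hcard := Finset.card_filter_add_card_filter_not (s := (Finset.univ : Finset (Fin (d+2))))
    (fun i => hM.eigenvalues i = 0)
  rw [Finset.card_univ, Fintype.card_fin] at hcard
  obtain ⟨q, hq⟩ := gram_rep (d := d) M hM hpos (by
    simp only [ne_eq]
    omega)
  exact ⟨_, q, hq⟩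

theorem exists_bad (G : SimpleGraph (Fin (d+2))) (hG : ¬ IsCompleteMultipartite G) :
    ∃ x y z, ¬ G.Adj x y ∧ ¬ G.Adj y z ∧ G.Adj x z := by
  by_contra hcon
  push Not at hcon
  apply hG
  let st : Setoid (Fin (d+2)) :=
    { r := fun a b => ¬ G.Adj a b
      iseqv := ⟨fun a => G.loopless.irrefl a, fun h h' => h h'.symm, fun {a b c} h h' => hcon a b c h h'⟩ }
  refine ⟨fun i => (Quotient.mk st i).out, fun i j => ?_⟩
  have : (Quotient.mk st i).out = (Quotient.mk st j).out ↔ ¬ G.Adj i j := by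
    rw [Quotient.out_inj, Quotient.eq]
    exact Iff.rfl
  simp only [ne_eq, this, not_not]

theorem forward (G : SimpleGraph (Fin (d+2))) [DecidableRel G.Adj]
    (hA : (G.adjMatrix ℝ).IsHermitian)
    (h : Spherical (d+2) d G) : ∃ c : ℝ,
    (∀ w : Fin (d+2) → ℝ, ∑ i, w i = 0 → w ⬝ᵥ (G.adjMatrix ℝ *ᵥ w) ≤ c * (w ⬝ᵥ w)) ∧
    (∀ w : Fin (d+2) → ℝ, ∑ i, w i = 0 → w ⬝ᵥ (G.adjMatrix ℝ *ᵥ w) = c * (w ⬝ᵥ w) →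
      G.adjMatrix ℝ *ᵥ w = c • w) ∧
    ∃ w : Fin (d+2) → ℝ, w ≠ 0 ∧ ∑ i, w i = 0 ∧ G.adjMatrix ℝ *ᵥ w = c • w := by
  obtain ⟨k, p, ctr, r, ⟨a, b, hab, hb0, -, hadj, hnadj, -, -⟩, hr⟩ := h
  set A := G.adjMatrix ℝ with hAdef
  set q : Fin (d+2) → EuclideanSpace ℝ (Fin d) := fun i => p i - ctr with hq
  have hκ : 0 < a^2 - b^2 := by nlinarith
  have hinner : ∀ i j, 2 * inner ℝ (q i) (q j) =
      (((2*r^2 - b^2) • Jmat (d+2) + (b^2) • (1 : Matrix (Fin (d+2)) (Fin (d+2)) ℝ)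
        - (a^2-b^2) • A) i j : ℝ) := by
    intro i j
    have hn : ∀ i, ‖q i‖ = r := fun i => by rw [← hr i, dist_eq_norm]
    have h1 := norm_sub_sq_real (q i) (q j)
    have h2 : ‖q i - q j‖ = dist (p i) (p j) := by rw [dist_eq_norm]; simp [hq]
    rw [h2, hn, hn] at h1
    simp only [Matrix.sub_apply, Matrix.add_apply, Matrix.smul_apply, Jmat, Matrix.of_apply,
      Matrix.one_apply, hAdef, SimpleGraph.adjMatrix_apply, smul_eq_mul]
    by_cases hij : i = j
    · subst hij
      simp at h1 ⊢
      rw [hn]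
    · by_cases hg : G.Adj i j
      · rw [hadj i j hg] at h1
        simp [hij, hg]; linarith
      · rw [hnadj i j hij hg] at h1
        simp [hij, hg]; linarith
  have hquad : ∀ y w : Fin (d+2) → ℝ, 2 * inner ℝ (∑ i, y i • q i) (∑ j, w j • q j) =
      (2*r^2 - b^2) * ((∑ i, y i) * ∑ i, w i) + b^2 * (y ⬝ᵥ w) - (a^2-b^2) * (y ⬝ᵥ (A *ᵥ w)) := by
    intro y w
    have e : (2*r^2 - b^2) * ((∑ i, y i) * ∑ i, w i) + b^2 * (y ⬝ᵥ w)
        - (a^2-b^2) * (y ⬝ᵥ (A *ᵥ w)) =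
        y ⬝ᵥ (((2*r^2 - b^2) • Jmat (d+2) + (b^2) • (1 : Matrix (Fin (d+2)) (Fin (d+2)) ℝ)
        - (a^2-b^2) • A) *ᵥ w) := by
      rw [sub_mulVec, add_mulVec, smul_mulVec, smul_mulVec, smul_mulVec, one_mulVec,
        dotProduct_sub, dotProduct_add, dotProduct_smul, dotProduct_smul, dotProduct_smul, J_dot]
      simp only [smul_eq_mul]
    rw [e]
    simp only [sum_inner, inner_sum, inner_smul_left, inner_smul_right, conj_trivial, dotProduct,
      mulVec, ← hinner, Finset.mul_sum]
    rw [Finset.sum_comm]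
    refine Finset.sum_congr rfl fun i _ => Finset.sum_congr rfl fun j _ => ?_
    ring
  have hzero : ∀ w : Fin (d+2) → ℝ, ∑ i, w i = 0 → ∑ i, w i • q i = 0 →
      A *ᵥ w = (b^2/(a^2-b^2)) • w := by
    intro w hw hx
    refine eq_of_dot _ _ fun y => ?_
    have := hquad y w
    rw [hx, inner_zero_right, hw] at this
    rw [dotProduct_smul, smul_eq_mul]
    field_simp
    linarith
  have hself : ∀ w : Fin (d+2) → ℝ, ∑ i, w i = 0 → 2 * ‖∑ i, w i • q i‖^2 =
      b^2 * (w ⬝ᵥ w) - (a^2-b^2) * (w ⬝ᵥ (A *ᵥ w)) := by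
    intro w hw
    have := hquad w w
    rw [hw, real_inner_self_eq_norm_sq] at this
    linarith
  refine ⟨b^2/(a^2-b^2), ?_, ?_, ?_⟩
  · intro w hw
    have := hself w hw
    rw [div_mul_eq_mul_div, le_div_iff₀ hκ]
    nlinarith [sq_nonneg ‖∑ i, w i • q i‖]
  · intro w hw he
    apply hzero w hw
    have := hself w hw
    rw [he] at this
    have h0 : 2 * ‖∑ i, w i • q i‖^2 = 0 := by
      rw [this]; field_simp; ring
    simpa using h0
  · let T : (Fin (d+2) → ℝ) →ₗ[ℝ] (EuclideanSpace ℝ (Fin d) × ℝ) :=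
      (Fintype.linearCombination ℝ q).prod (∑ i : Fin (d+2), LinearMap.proj i)
    have hT : LinearMap.ker T ≠ ⊥ := by
      apply LinearMap.ker_ne_bot_of_finrank_lt
      simp
    obtain ⟨w, hw, hne⟩ := (Submodule.ne_bot_iff _).mp hT
    rw [LinearMap.mem_ker] at hw
    have h1 := congrArg Prod.fst hw
    have h2 := congrArg Prod.snd hw
    simp [T, Fintype.linearCombination_apply] at h1 h2
    exact ⟨w, hne, h2, hzero w h2 h1⟩

end


/-- **Theorem 1 (main result).** A non-complete-multipartite graph `G` on `d+2`
vertices has a spherical representation in `ℝ^d` iff the maximum eigenvalue of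
`P·A_G·P` restricted to `𝟙^⊥` is `λ₂` and the multiplicity of `λ₂` in
`P·A_G·P` restricted to `𝟙^⊥` equals its multiplicity in `A_G` (diminished by
one if `λ₁ = λ₂`). -/
theorem stmt0 (d : ℕ) (hd : 0 < d) (G : SimpleGraph (Fin (d+2))) [DecidableRel G.Adj]
    (hG : ¬ IsCompleteMultipartite G)
    (hA : (G.adjMatrix ℝ).IsHermitian)
    (μ : Fin (d+2) → ℝ) (hmono : Antitone μ)
    (hperm : ∃ σ : Equiv.Perm (Fin (d+2)), μ = hA.eigenvalues ∘ σ)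
    (P : Matrix (Fin (d+2)) (Fin (d+2)) ℝ)
    (hP : P = 1 - ((d : ℝ) + 2)⁻¹ • Jmat (d+2))
    (m : ℕ)
    (hm : m = (Finset.univ.filter fun i => μ i = μ 1).card
        - (if μ 0 = μ 1 then 1 else 0)) :
    Spherical (d+2) d G ↔
      (IsGreatest {t : ℝ | ∃ w : Fin (d+2) → ℝ, (∑ i, w i) = 0 ∧ w ≠ 0 ∧
          (P * G.adjMatrix ℝ * P).mulVec w = t • w} (μ 1) ∧
       Module.finrank ℝ
          ↥(Module.End.eigenspace (P * G.adjMatrix ℝ * P).mulVecLin (μ 1)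
              ⊓ onePerp (d+2)) = m) := by
  obtain ⟨σ, hσ⟩ := hperm
  obtain ⟨f', hon', hf', hv'⟩ := eig_data (G.adjMatrix ℝ) hA
  obtain ⟨f, hon, hf, hv⟩ : ∃ f : Fin (d+2) → (Fin (d+2) → ℝ),
      (∀ i j, f i ⬝ᵥ f j = if i = j then 1 else 0) ∧
      (∀ i, G.adjMatrix ℝ *ᵥ f i = μ i • f i) ∧
      (∀ v : Fin (d+2) → ℝ, v = ∑ i, (f i ⬝ᵥ v) • f i) := by
    refine ⟨fun i => f' (σ i), fun i j => ?_, fun i => ?_, fun v => ?_⟩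
    · rw [hon']; simp
    · rw [hf', hσ]; rfl
    · rw [Equiv.sum_comp σ (fun i => (f' i ⬝ᵥ v) • f' i)]
      exact hv' v
  set A := G.adjMatrix ℝ with hAdef
  have hnn : ∀ i j, 0 ≤ A i j := by
    intro i j
    rw [hAdef, SimpleGraph.adjMatrix_apply]
    split_ifs <;> norm_num
  have hne : ∀ i, f i ≠ 0 := fun i h => by
    have := hon i i
    rw [h] at this; simp at this
  have hEle : ∀ c, Module.End.eigenspace A.mulVecLin c ⊓ onePerp (d+2) ≤
      Module.End.eigenspace (P * A * P).mulVecLin c ⊓ onePerp (d+2) := by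
    rintro c w ⟨hw1, hw2⟩
    refine ⟨?_, hw2⟩
    have hw2' := (mem_onePerp w).mp hw2
    simp only [SetLike.mem_coe, Module.End.mem_eigenspace_iff, mulVecLin_apply] at hw1 ⊢
    exact PAP_of_eig A P hP w c hw2' hw1
  constructor
  · intro hsph
    obtain ⟨c, hb, hz, w0, hw0, hs0, hA0⟩ := forward G hA hsph
    have h1 : μ 1 ≤ c := interlace A f μ hmono hon hf c hb
    have hc : c = μ 1 := by
      by_cases hlt : μ 1 = c
      · exact hlt.symm
      exfalso
      have hlt : μ 1 < c := lt_of_le_of_ne h1 hlt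
      have hmem0 : w0 ∈ Module.End.eigenspace A.mulVecLin c := by
        rw [Module.End.mem_eigenspace_iff]; exact hA0
      have hfin := finrank_eigen A hA f μ hon hf hv c
      have hone : ∀ i, μ i = c → i = 0 := by
        intro i hi
        by_contra h0
        have : μ i ≤ μ 1 := hmono (Fin.one_le_of_ne_zero h0)
        linarith
      have hcard : (Finset.univ.filter fun i => μ i = c).card ≤ 1 := by
        rw [Finset.card_le_one]
        intro i hi j hj
        rw [hone i (by simpa using hi), hone j (by simpa using hj)]
      have hpos : 0 < Module.finrank ℝ
          ↥(Module.End.eigenspace A.mulVecLin c ⊓ onePerp (d+2)) := by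
        rw [Module.finrank_pos_iff_exists_ne_zero]
        exact ⟨⟨w0, hmem0, (mem_onePerp w0).mpr hs0⟩, fun h => hw0 (congrArg Subtype.val h)⟩
      have hle1 : Module.finrank ℝ ↥(Module.End.eigenspace A.mulVecLin c ⊓ onePerp (d+2)) ≤
          Module.finrank ℝ ↥(Module.End.eigenspace A.mulVecLin c) :=
        Submodule.finrank_mono inf_le_left
      have hc0 : μ 0 = c := by
        have : 0 < (Finset.univ.filter fun i => μ i = c).card := by omega
        obtain ⟨i, hi⟩ := Finset.card_pos.mp this
        have hi' : μ i = c := by simpa using hi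
        rwa [hone i hi'] at hi'
      obtain ⟨u, hu, hus⟩ := perron A hA hnn c (fun v =>
        quad_le A hA f μ hf hv _ v (fun i => Or.inr (hc0 ▸ hmono (Fin.zero_le i)))) w0 hw0 hA0
      have hr := finrank_inf_onePerp (Module.End.eigenspace A.mulVecLin c) (fun hle =>
        hus ((mem_onePerp u).mp (hle (by rw [Module.End.mem_eigenspace_iff]; exact hu))))
      omega
    subst hc
    have hEN : Module.End.eigenspace (P * A * P).mulVecLin (μ 1) ⊓ onePerp (d+2) =
        Module.End.eigenspace A.mulVecLin (μ 1) ⊓ onePerp (d+2) := by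
      refine le_antisymm ?_ (hEle _)
      rintro w ⟨hw1, hw2⟩
      refine ⟨?_, hw2⟩
      have hw2' := (mem_onePerp w).mp hw2
      simp only [SetLike.mem_coe, Module.End.mem_eigenspace_iff, mulVecLin_apply] at hw1 ⊢
      apply hz w hw2'
      rw [← PAP_dot A P hP w w hw2' hw2', hw1, dotProduct_smul, smul_eq_mul]
    refine ⟨⟨⟨w0, hs0, hw0, PAP_of_eig A P hP w0 _ hs0 hA0⟩, ?_⟩, ?_⟩
    · rintro t ⟨w, hw, hwne, hwt⟩
      have h2 := hb w hw
      rw [← PAP_dot A P hP w w hw hw, hwt, dotProduct_smul, smul_eq_mul] at h2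
      exact le_of_mul_le_mul_right h2 (dot_self_pos' hwne)
    · rw [hEN, hm]
      exact finrank_m A hA hnn f μ hmono hon hf hv hb
  · rintro ⟨⟨⟨w1, hw1s, hw1n, hw1⟩, hub⟩, hfin⟩
    have hb := form_bound A P hA hP (μ 1) (fun t ht => hub ht)
    have hEN : Module.End.eigenspace A.mulVecLin (μ 1) ⊓ onePerp (d+2) =
        Module.End.eigenspace (P * A * P).mulVecLin (μ 1) ⊓ onePerp (d+2) := by
      apply Submodule.eq_of_le_of_finrank_eq (hEle _)
      rw [hfin, hm]
      exact finrank_m A hA hnn f μ hmono hon hf hv hb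
    have hPAP : ∀ w : Fin (d+2) → ℝ, ∑ i, w i = 0 → (P * A * P) *ᵥ w = μ 1 • w →
        A *ᵥ w = μ 1 • w := by
      intro w hw he
      have : w ∈ Module.End.eigenspace A.mulVecLin (μ 1) ⊓ onePerp (d+2) := by
        rw [hEN]
        refine ⟨?_, (mem_onePerp w).mpr hw⟩
        simp only [SetLike.mem_coe, Module.End.mem_eigenspace_iff]
        exact he
      exact Module.End.mem_eigenspace_iff.mp this.1
    obtain ⟨t, q, hq⟩ := construct A hA (μ 1) (fun w hw hy => by
      apply hPAP w hw
      have hPh : P.IsHermitian := by rw [hP]; exact P_herm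
      have hPw : P *ᵥ w = w := by rw [hP]; exact P_mulVec_perp hw
      refine eq_of_dot _ _ fun y => ?_
      have h1 : ∑ i, (P *ᵥ y) i = 0 := by rw [hP]; exact P_sum y
      have h2 := hy _ h1
      rw [← mulVec_mulVec, ← mulVec_mulVec, hPw, symm_dot P hPh, dotProduct_comm, h2,
        dotProduct_comm, symm_dot P hPh, hPw, dotProduct_smul, smul_eq_mul]) hb w1 hw1n hw1s
        (hPAP w1 hw1s hw1)
    obtain ⟨x, y, z, hxy, hyz, hxz⟩ := exists_bad G hG
    have hxny : x ≠ y := fun e => hyz (e ▸ hxz)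
    have hynz : y ≠ z := fun e => hxy (e ▸ hxz)
    have hpos : 0 < μ 1 := by
      have h1 := hb (Pi.single x 1 + Pi.single z 1 - (2:ℝ) • Pi.single y 1) (by
        simp [Finset.sum_add_distrib, Finset.sum_sub_distrib, ← Finset.mul_sum]; norm_num)
      have hyx : ¬ G.Adj y x := fun h => hxy h.symm
      have hzy : ¬ G.Adj z y := fun h => hyz h.symm
      have e1 : ∀ i j, Pi.single i (1:ℝ) ⬝ᵥ (A *ᵥ Pi.single j 1) = A i j := by
        intro i j; simp
      have e2 : ∀ i j : Fin (d+2), Pi.single i (1:ℝ) ⬝ᵥ (Pi.single j (1:ℝ)) = if i = j then 1 else 0 := by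
        intro i j; simp [Pi.single_apply, eq_comm]
      simp only [mulVec_add, mulVec_sub, mulVec_smul, dotProduct_add, dotProduct_sub,
        dotProduct_smul, add_dotProduct, sub_dotProduct, smul_dotProduct, e1, e2] at h1
      simp only [hAdef, SimpleGraph.adjMatrix_apply] at h1
      simp [hxy, hyz, hxz, hxz.symm, hyx, hzy, hxny, hxny.symm, hynz, hynz.symm, hxz.ne,
        hxz.ne.symm] at h1
      by_contra hle
      push Not at hle
      nlinarith
    have hdist : ∀ i j, i ≠ j → dist (q i) (q j) = √(2 * μ 1 + 2 * A i j) := by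
      intro i j hij
      have h1 := norm_sub_sq_real (q i) (q j)
      rw [← real_inner_self_eq_norm_sq (q i), ← real_inner_self_eq_norm_sq (q j), hq, hq, hq] at h1
      rw [dist_eq_norm, ← Real.sqrt_sq (norm_nonneg (q i - q j)), h1]
      congr 1
      simp [hij, Jmat, hAdef]
      split_ifs <;> ring
    refine ⟨√(2 * μ 1 + 2) / √(2 * μ 1), q, 0, √(μ 1 + t), ⟨√(2 * μ 1 + 2), √(2 * μ 1),
      ?_, ?_, rfl, ?_, ?_, ⟨x, z, hxz⟩, ⟨x, y, hxny, hxy⟩⟩, ?_⟩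
    · exact Real.sqrt_lt_sqrt (by linarith) (by linarith)
    · exact Real.sqrt_pos.mpr (by linarith)
    · intro i j hij
      rw [hdist i j hij.ne, hAdef, SimpleGraph.adjMatrix_apply, if_pos hij, mul_one]
    · intro i j hne' hij
      rw [hdist i j hne', hAdef, SimpleGraph.adjMatrix_apply, if_neg hij, mul_zero, add_zero]
    · intro i
      rw [dist_zero_right, ← Real.sqrt_sq (norm_nonneg (q i)), ← real_inner_self_eq_norm_sq, hq]
      congr 1
      simp [Jmat, hAdef]
end

section
/- Let G be a graph on d+2 vertices that is not complete multipartite, with adjacency matrix A_G and second largest eigenvalue λ₂, and set B̄ = λ₂·I − A_G. Then G has a spherical representation in ℝ^d if and only if wᵀ·B̄·w ≥ 0 for every w ∈ 𝟙^⊥ and 𝟙ᵀ·A_G·w = 0 for every w ∈ 𝟙^⊥ with wᵀ·B̄·w = 0. -/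
open Matrix Finset
open scoped Classical

lemma eig (d : ℕ) (A : Matrix (Fin (d+2)) (Fin (d+2)) ℝ) (hA : A.IsHermitian)
    (μ : Fin (d+2) → ℝ) 
    (hperm : ∃ σ : Equiv.Perm (Fin (d+2)), μ = hA.eigenvalues ∘ σ) :
    ∃ e : Fin (d+2) → Fin (d+2) → ℝ, (∀ i, A *ᵥ e i = μ i • e i) ∧
      (∀ i j, e i ⬝ᵥ e j = if i = j then 1 else 0) ∧
      (∀ u, u = ∑ i, (e i ⬝ᵥ u) • e i) := by
  obtain ⟨σ, rfl⟩ := hperm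
  refine ⟨fun i => (hA.eigenvectorBasis (σ i)).ofLp, fun i => ?_, fun i j => ?_, fun u => ?_⟩
  · exact hA.mulVec_eigenvectorBasis (σ i)
  · have := orthonormal_iff_ite.1 hA.eigenvectorBasis.orthonormal (σ j) (σ i)
    rw [EuclideanSpace.inner_eq_star_dotProduct] at this
    simp only [star_trivial, EmbeddingLike.apply_eq_iff_eq] at this
    rw [this]; simp [eq_comm]
  · have := hA.eigenvectorBasis.sum_repr' (WithLp.toLp 2 u)
    rw [← Equiv.sum_comp σ] at this
    have h2 := congrArg WithLp.ofLp this
    simp only [EuclideanSpace.inner_eq_star_dotProduct, star_trivial] at h2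
    rw [WithLp.ofLp_sum] at h2
    simp only [dotProduct_comm u] at h2
    exact h2.symm

lemma sym_dot {n : ℕ} {A : Matrix (Fin n) (Fin n) ℝ} (hA : A.IsHermitian) (u v : Fin n → ℝ) :
    u ⬝ᵥ A *ᵥ v = v ⬝ᵥ A *ᵥ u := by
  have h : Aᵀ = A := by simpa [Matrix.IsHermitian, Matrix.conjTranspose_eq_transpose_of_trivial] using hA
  rw [Matrix.dotProduct_mulVec, dotProduct_comm, ← Matrix.mulVec_transpose, h]

lemma top_vec (d : ℕ) (A : Matrix (Fin (d+2)) (Fin (d+2)) ℝ)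
    (μ : Fin (d+2) → ℝ) (hmono : Antitone μ) (e : Fin (d+2) → Fin (d+2) → ℝ)
    (h1 : ∀ i, A *ᵥ e i = μ i • e i)
    (h2 : ∀ i j, e i ⬝ᵥ e j = if i = j then 1 else 0) :
    ∃ v : Fin (d+2) → ℝ, v ≠ 0 ∧ ∑ i, v i = 0 ∧ μ 1 * (v ⬝ᵥ v) ≤ v ⬝ᵥ A *ᵥ v := by
  have key : ∃ x y : ℝ, (x ≠ 0 ∨ y ≠ 0) ∧ x * (∑ i, e 0 i) + y * (∑ i, e 1 i) = 0 := by
    by_cases h : ∑ i, e 0 i = 0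
    · exact ⟨1, 0, Or.inl one_ne_zero, by simp [h]⟩
    · exact ⟨∑ i, e 1 i, -∑ i, e 0 i, Or.inr (neg_ne_zero.2 h), by ring⟩
  obtain ⟨x, y, hxy, hs⟩ := key
  have h01 : (0 : Fin (d+2)) ≠ 1 := by simp
  have hvv : (x • e 0 + y • e 1) ⬝ᵥ (x • e 0 + y • e 1) = x^2 + y^2 := by
    simp [add_dotProduct, dotProduct_add, h2]; ring
  have hpos : 0 < x^2 + y^2 := by
    rcases hxy with h | h <;> positivity
  refine ⟨x • e 0 + y • e 1, ?_, ?_, ?_⟩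
  · intro h0
    rw [h0] at hvv
    simp at hvv
    linarith
  · simpa [Finset.sum_add_distrib, ← Finset.mul_sum] using hs
  · have h3 : (x • e 0 + y • e 1) ⬝ᵥ A *ᵥ (x • e 0 + y • e 1) = μ 0 * x^2 + μ 1 * y^2 := by
      simp [Matrix.mulVec_add, Matrix.mulVec_smul, h1, add_dotProduct, dotProduct_add, h2]; ring
    rw [hvv, h3]
    nlinarith [hmono (Fin.zero_le (1 : Fin (d+2))), sq_nonneg x]

lemma perron_s15 (d : ℕ) (A : Matrix (Fin (d+2)) (Fin (d+2)) ℝ) (hA : A.IsHermitian)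
    (hnn : ∀ i j, 0 ≤ A i j)
    (μ : Fin (d+2) → ℝ) (hmono : Antitone μ) (e : Fin (d+2) → Fin (d+2) → ℝ)
    (h1 : ∀ i, A *ᵥ e i = μ i • e i)
    (h3 : ∀ u, u = ∑ i, (e i ⬝ᵥ u) • e i)
    (s : ℝ) (hs : μ 1 < s) (w : Fin (d+2) → ℝ) (hw : w ≠ 0) (hAw : A *ᵥ w = s • w)
    (hsum : ∑ i, w i = 0) : False := by
  have hlt : ∀ i, i ≠ 0 → μ i < s := fun i hi => by
    refine lt_of_le_of_lt (hmono ?_) hs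
    rw [Fin.le_def]
    have : i.val ≠ 0 := fun h => hi (Fin.ext h)
    simp; omega
  have heA : ∀ i u, e i ⬝ᵥ A *ᵥ u = μ i * (e i ⬝ᵥ u) := fun i u => by
    rw [sym_dot hA, h1, dotProduct_smul, smul_eq_mul, dotProduct_comm]
  have hc : ∀ i, (μ i - s) * (e i ⬝ᵥ w) = 0 := fun i => by
    have := heA i w
    rw [hAw, dotProduct_smul, smul_eq_mul] at this
    linarith
  have hred : ∀ u, (∀ i, i ≠ 0 → e i ⬝ᵥ u = 0) → u = (e 0 ⬝ᵥ u) • e 0 := fun u hu => by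
    conv_lhs => rw [h3 u]
    refine Finset.sum_eq_single 0 (fun i _ hi => by rw [hu i hi, zero_smul]) (by simp)
  have hw0 : w = (e 0 ⬝ᵥ w) • e 0 := hred w fun i hi => by
    rcases mul_eq_zero.1 (hc i) with h | h
    · linarith [hlt i hi]
    · exact h
  have ha0 : e 0 ⬝ᵥ w ≠ 0 := fun h => hw (by rw [hw0, h, zero_smul])
  have hμ0 : μ 0 = s := by
    rcases mul_eq_zero.1 (hc 0) with h | h
    · linarith
    · exact absurd h ha0
  have he0 : ∑ i, e 0 i = 0 := by
    rw [hw0] at hsum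
    simp only [Pi.smul_apply, smul_eq_mul, ← Finset.mul_sum] at hsum
    exact (mul_eq_zero.1 hsum).resolve_left ha0
  set u : Fin (d+2) → ℝ := fun i => |w i| with hu
  have hquad : s * (u ⬝ᵥ u) ≤ u ⬝ᵥ A *ᵥ u := by
    have e1 : s * (u ⬝ᵥ u) = w ⬝ᵥ A *ᵥ w := by
      rw [hAw, dotProduct_smul, smul_eq_mul]
      simp [dotProduct, hu, abs_mul_abs_self]
    rw [e1]
    simp only [dotProduct, Matrix.mulVec, Finset.mul_sum]
    refine Finset.sum_le_sum fun i _ => Finset.sum_le_sum fun j _ => ?_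
    have : w i * w j ≤ |w i| * |w j| := by rw [← abs_mul]; exact le_abs_self _
    simp only [hu]
    nlinarith [hnn i j]
  have hpars : ∀ x y : Fin (d+2) → ℝ, x ⬝ᵥ y = ∑ i, (e i ⬝ᵥ x) * (e i ⬝ᵥ y) := fun x y => by
    conv_lhs => rw [h3 x]
    rw [sum_dotProduct]
    simp
  have hS : ∑ i, (s - μ i) * (e i ⬝ᵥ u)^2 ≤ 0 := by
    rw [hpars u u, hpars u (A *ᵥ u), Finset.mul_sum] at hquad
    simp only [heA] at hquad
    rw [← sub_nonpos, ← Finset.sum_sub_distrib] at hquad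
    refine le_trans (le_of_eq (Finset.sum_congr rfl fun i _ => ?_)) hquad
    ring
  have hnonneg : ∀ i ∈ Finset.univ, 0 ≤ (s - μ i) * (e i ⬝ᵥ u)^2 := fun i _ => by
    by_cases hi : i = 0
    · subst hi; rw [hμ0]; simp
    · have := hlt i hi
      exact mul_nonneg (by linarith) (sq_nonneg _)
  have hz := (Finset.sum_eq_zero_iff_of_nonneg hnonneg).1 (le_antisymm hS (Finset.sum_nonneg hnonneg))
  have hu0 : u = (e 0 ⬝ᵥ u) • e 0 := hred u fun i hi => by
    rcases mul_eq_zero.1 (hz i (Finset.mem_univ i)) with h | h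
    · linarith [hlt i hi]
    · exact pow_eq_zero_iff (two_ne_zero) |>.1 h
  have hus : ∑ i, u i = 0 := by
    rw [hu0]
    simp only [Pi.smul_apply, smul_eq_mul, ← Finset.mul_sum, he0, mul_zero]
  apply hw
  funext i
  have := (Finset.sum_eq_zero_iff_of_nonneg (fun i _ => abs_nonneg (w i))).1 hus i (Finset.mem_univ i)
  simpa using this

open scoped MatrixOrder Matrix.Norms.L2Operator in
lemma psd_sqrt {n : ℕ} (M : Matrix (Fin n) (Fin n) ℝ) (h : M.PosSemidef) :
    ∃ C : Matrix (Fin n) (Fin n) ℝ, C.IsHermitian ∧ C * C = M :=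
  ⟨CFC.sqrt M, (Matrix.nonneg_iff_posSemidef.1 (CFC.sqrt_nonneg M)).1, CFC.sqrt_mul_sqrt_self M h.nonneg⟩

lemma gram_real (d : ℕ) (M : Matrix (Fin (d+2)) (Fin (d+2)) ℝ) (hM : M.PosSemidef)
    (v y : Fin (d+2) → ℝ) (hv : M *ᵥ v = 0) (hy : M *ᵥ y = 0) (hli : LinearIndependent ℝ ![v, y]) :
    ∃ q : Fin (d+2) → EuclideanSpace ℝ (Fin d), ∀ i j, inner ℝ (q i) (q j) = M i j := by
  obtain ⟨C, hC, hCC⟩ := psd_sqrt M hM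
  have hCt : Cᵀ = C := by simpa [Matrix.IsHermitian, Matrix.conjTranspose_eq_transpose_of_trivial] using hC
  have hker : ∀ z, M *ᵥ z = 0 → C *ᵥ z = 0 := fun z hz => by
    have : (C *ᵥ z) ⬝ᵥ (C *ᵥ z) = 0 := by
      rw [sym_dot hC, Matrix.mulVec_mulVec, hCC, hz, dotProduct_zero]
    exact dotProduct_self_eq_zero.1 this
  let b : Fin 2 → EuclideanSpace ℝ (Fin (d+2)) := fun i => WithLp.toLp 2 (![v, y] i)
  have hb : LinearIndependent ℝ b := by
    have := hli.map' (WithLp.linearEquiv 2 ℝ (Fin (d+2) → ℝ)).symm.toLinearMap (LinearEquiv.ker _)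
    exact this
  let K : Submodule ℝ (EuclideanSpace ℝ (Fin (d+2))) := Submodule.span ℝ (Set.range b)
  have hK : Module.finrank ℝ K = 2 := by
    simpa using finrank_span_eq_card hb
  have hKo : Module.finrank ℝ Kᗮ = d := by
    have := K.finrank_add_finrank_orthogonal
    simp [hK] at this
    omega
  have hmem : ∀ i, WithLp.toLp 2 (C i) ∈ Kᗮ := fun i => by
    rw [Submodule.mem_orthogonal]
    intro u hu
    induction hu using Submodule.span_induction with
    | mem x hx =>
      obtain ⟨j, rfl⟩ := hx
      rw [EuclideanSpace.inner_eq_star_dotProduct]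
      fin_cases j
      · exact congrFun (hker v hv) i
      · exact congrFun (hker y hy) i
    | zero => simp
    | add x y _ _ hx hy => rw [inner_add_left, hx, hy, add_zero]
    | smul a x _ hx => rw [inner_smul_left, hx, mul_zero]
  let B := (stdOrthonormalBasis ℝ Kᗮ).reindex (finCongr hKo)
  refine ⟨fun i => B.repr ⟨_, hmem i⟩, fun i j => ?_⟩
  rw [LinearIsometryEquiv.inner_map_map, Submodule.coe_inner, EuclideanSpace.inner_eq_star_dotProduct,
    ← hCC, Matrix.mul_apply]
  simp only [star_trivial, dotProduct]
  refine Finset.sum_congr rfl fun k _ => ?_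
  rw [mul_comm, ← congrFun (congrFun hCt k) j, Matrix.transpose_apply]

lemma exists_triple {n : ℕ} (G : SimpleGraph (Fin n)) (hG : ¬ IsCompleteMultipartite G) :
    ∃ i j k, G.Adj i j ∧ ¬ G.Adj k i ∧ ¬ G.Adj k j := by
  by_contra! hcon
  apply hG
  let S : Setoid (Fin n) := ⟨fun i j => ¬ G.Adj i j, fun i => G.loopless.irrefl i,
    fun h h' => h h'.symm, fun {a b c} hab hbc hac => hbc (hcon a c b hac (fun h => hab h.symm))⟩
  refine ⟨fun i => (Quotient.mk S i).out, fun i j => ?_⟩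
  rw [Ne, Quotient.out_inj, Quotient.eq]
  change _ ↔ ¬ ¬ _
  rw [not_not]

lemma solve_one {n : ℕ} (B : Matrix (Fin n) (Fin n) ℝ) (hB : B.IsHermitian)
    (h : ∀ z, B *ᵥ z = 0 → ∑ i, z i = 0) : ∃ y, B *ᵥ y = fun _ => 1 := by
  have hs := Matrix.isSymmetric_toEuclideanLin_iff.2 hB
  have : (WithLp.toLp 2 (fun _ => (1:ℝ)) : EuclideanSpace ℝ (Fin n)) ∈ (Matrix.toEuclideanLin B).range := by
    rw [← Submodule.orthogonal_orthogonal (Matrix.toEuclideanLin B).range, hs.orthogonal_range,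
      Submodule.mem_orthogonal]
    intro u hu
    have hu' : B *ᵥ u.ofLp = 0 := by
      have := congrArg WithLp.ofLp (LinearMap.mem_ker.1 hu)
      simpa using this
    have := h _ hu'
    rw [EuclideanSpace.inner_eq_star_dotProduct]
    simpa [dotProduct] using this
  obtain ⟨y, hy⟩ := this
  exact ⟨y.ofLp, by simpa using congrArg WithLp.ofLp hy⟩

lemma fwd (d : ℕ) (G : SimpleGraph (Fin (d+2))) [DecidableRel G.Adj]
    (hA : (G.adjMatrix ℝ).IsHermitian)
    (μ : Fin (d+2) → ℝ) (hmono : Antitone μ)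
    (hperm : ∃ σ : Equiv.Perm (Fin (d+2)), μ = hA.eigenvalues ∘ σ)
    (h : Spherical (d+2) d G) :
    (∀ w : Fin (d+2) → ℝ, (∑ i, w i) = 0 → 0 ≤ μ 1 * (w ⬝ᵥ w) - w ⬝ᵥ (G.adjMatrix ℝ) *ᵥ w) ∧
    (∀ w : Fin (d+2) → ℝ, (∑ i, w i) = 0 → μ 1 * (w ⬝ᵥ w) - w ⬝ᵥ (G.adjMatrix ℝ) *ᵥ w = 0 →
          (fun _ => (1 : ℝ)) ⬝ᵥ (G.adjMatrix ℝ).mulVec w = 0) := by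
  obtain ⟨e, h1, h2, h3⟩ := eig d _ hA μ hperm
  obtain ⟨k, p, c, r, ⟨α₁, α₂, hlt, hpos, -, hadj, hnadj, -, -⟩, hr⟩ := h
  set A := G.adjMatrix ℝ with hAdef
  set a := α₂ ^ 2 with ha
  set b := α₁ ^ 2 - α₂ ^ 2 with hb
  have hbpos : 0 < b := by rw [hb]; nlinarith
  set q : Fin (d+2) → EuclideanSpace ℝ (Fin d) := fun i => p i - c with hq
  have hqn : ∀ i, ‖q i‖ = r := fun i => by rw [hq, ← hr i, dist_eq_norm]
  have hdist : ∀ i j, ‖q i - q j‖ = dist (p i) (p j) := fun i j => by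
    rw [dist_eq_norm]; simp [hq]
  have hin : ∀ i j, 2 * inner ℝ (q i) (q j) =
      2 * r^2 - a * (1 - if i = j then 1 else 0) - b * A i j := fun i j => by
    have hh := norm_sub_sq_real (q i) (q j)
    rw [hqn, hqn, hdist] at hh
    by_cases hij : i = j
    · subst hij
      simp at hh
      simp [hAdef]; linarith
    · by_cases hadj' : G.Adj i j
      · rw [hadj i j hadj'] at hh
        simp [hAdef, hij, hadj', ha, hb]; linarith
      · rw [hnadj i j hij hadj'] at hh
        simp [hAdef, hij, hadj', ha]; linarith
  have hE : ∀ w : Fin (d+2) → ℝ, ∑ i, w i = 0 → ∀ i,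
      2 * inner ℝ (q i) (∑ j, w j • q j) = a * w i - b * (A *ᵥ w) i := fun w hw i => by
    rw [inner_sum, Finset.mul_sum]
    have : ∀ j, 2 * inner ℝ (q i) (w j • q j) =
        (2 * r^2 - a) * w j + a * (if i = j then w j else 0) - b * (A i j * w j) := fun j => by
      rw [inner_smul_right]
      have := hin i j
      split_ifs at this ⊢ <;> linear_combination (w j) * this
    simp only [this]
    rw [Finset.sum_sub_distrib, Finset.sum_add_distrib, ← Finset.mul_sum, ← Finset.mul_sum,
      ← Finset.mul_sum, hw]
    simp [Matrix.mulVec, dotProduct]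
  have hQ : ∀ w : Fin (d+2) → ℝ, ∑ i, w i = 0 →
      2 * ‖∑ j, w j • q j‖^2 = a * (w ⬝ᵥ w) - b * (w ⬝ᵥ A *ᵥ w) := fun w hw => by
    rw [← real_inner_self_eq_norm_sq, sum_inner, Finset.mul_sum]
    simp only [dotProduct, Finset.mul_sum, ← Finset.sum_sub_distrib]
    refine Finset.sum_congr rfl fun i _ => ?_
    rw [real_inner_smul_left]
    linear_combination (w i) * hE w hw i
  have hZ : ∀ w : Fin (d+2) → ℝ, ∑ i, w i = 0 → ∑ j, w j • q j = 0 → A *ᵥ w = (a / b) • w := by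
    intro w hw h0
    funext i
    have := hE w hw i
    rw [h0, inner_zero_right] at this
    simp only [Pi.smul_apply, smul_eq_mul]
    field_simp
    linarith
  have hs : μ 1 = a / b := by
    apply le_antisymm
    · obtain ⟨v, hv0, hvs, hv⟩ := top_vec d A μ hmono e h1 h2
      have hvv : 0 < v ⬝ᵥ v := by
        have := dotProduct_self_eq_zero.not.2 hv0
        have h' : 0 ≤ v ⬝ᵥ v := Finset.sum_nonneg fun i _ => mul_self_nonneg _
        exact lt_of_le_of_ne h' (Ne.symm this)
      have := hQ v hvs
      rw [le_div_iff₀ hbpos]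
      have h' : 0 ≤ ‖∑ j, v j • q j‖^2 := sq_nonneg _
      by_contra! hcon
      nlinarith
    · by_contra! hcon
      let f : (Fin (d+2) → ℝ) →ₗ[ℝ] (EuclideanSpace ℝ (Fin d) × ℝ) :=
        (∑ j, (LinearMap.proj j : (Fin (d+2) → ℝ) →ₗ[ℝ] ℝ).smulRight (q j)).prod
          (∑ j, LinearMap.proj j)
      have hf : f.ker ≠ ⊥ := LinearMap.ker_ne_bot_of_finrank_lt (by simp)
      obtain ⟨w, hw, hw0⟩ := (Submodule.ne_bot_iff _).1 hf
      have hw' := LinearMap.mem_ker.1 hw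
      have hw1 : ∑ j, w j • q j = 0 := by simpa [f] using congrArg Prod.fst hw'
      have hw2 : ∑ j, w j = 0 := by simpa [f] using congrArg Prod.snd hw'
      refine perron_s15 d A hA (fun i j => ?_) μ hmono e h1 h3 (a/b) hcon w hw0 (hZ w hw2 hw1) hw2
      simp only [hAdef, SimpleGraph.adjMatrix_apply]
      split_ifs <;> norm_num
  have hQ' : ∀ w : Fin (d+2) → ℝ, ∑ i, w i = 0 →
      μ 1 * (w ⬝ᵥ w) - w ⬝ᵥ A *ᵥ w = 2 / b * ‖∑ j, w j • q j‖^2 := fun w hw => by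
    have := hQ w hw
    rw [hs]
    field_simp
    linarith
  refine ⟨fun w hw => ?_, fun w hw h0 => ?_⟩
  · rw [hQ' w hw]; positivity
  · rw [hQ' w hw] at h0
    have : ∑ j, w j • q j = 0 := by
      have h4 : 2 / b ≠ 0 := by positivity
      have := (mul_eq_zero.1 h0).resolve_left h4
      simpa using this
    rw [hZ w hw this]
    simp [dotProduct, ← Finset.mul_sum, hw]

lemma bwd (d : ℕ) (G : SimpleGraph (Fin (d+2))) [DecidableRel G.Adj]
    (hG : ¬ IsCompleteMultipartite G)
    (hA : (G.adjMatrix ℝ).IsHermitian)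
    (μ : Fin (d+2) → ℝ) (hmono : Antitone μ)
    (hperm : ∃ σ : Equiv.Perm (Fin (d+2)), μ = hA.eigenvalues ∘ σ)
    (B : Matrix (Fin (d+2)) (Fin (d+2)) ℝ)
    (hB : B = μ 1 • (1 : Matrix (Fin (d+2)) (Fin (d+2)) ℝ) - G.adjMatrix ℝ)
    (c1 : ∀ w : Fin (d+2) → ℝ, (∑ i, w i) = 0 → 0 ≤ w ⬝ᵥ B *ᵥ w)
    (c2 : ∀ w : Fin (d+2) → ℝ, (∑ i, w i) = 0 → w ⬝ᵥ B *ᵥ w = 0 →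
          (fun _ => (1 : ℝ)) ⬝ᵥ (G.adjMatrix ℝ).mulVec w = 0) : Spherical (d+2) d G := by
  obtain ⟨e, h1, h2, h3⟩ := eig d _ hA μ hperm
  obtain ⟨v, hv0, hvs, hv⟩ := top_vec d _ μ hmono e h1 h2
  have hBu : ∀ u, B *ᵥ u = μ 1 • u - (G.adjMatrix ℝ) *ᵥ u := fun u => by
    rw [hB, Matrix.sub_mulVec, Matrix.smul_mulVec, Matrix.one_mulVec]
  have hBh : B.IsHermitian := by
    rw [hB]
    refine Matrix.IsHermitian.sub ?_ hA
    simp [Matrix.IsHermitian]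
  have c2' : ∀ w : Fin (d+2) → ℝ, (∑ i, w i) = 0 → w ⬝ᵥ B *ᵥ w = 0 →
      ∑ i, (B *ᵥ w) i = 0 := fun w hw hw' => by
    have := c2 w hw hw'
    simp only [dotProduct, one_mul] at this
    simp only [hBu, Pi.sub_apply, Pi.smul_apply, smul_eq_mul, Finset.sum_sub_distrib,
      ← Finset.mul_sum, hw, this, mul_zero, sub_zero]
  have hvB : v ⬝ᵥ B *ᵥ v = 0 := by
    refine le_antisymm ?_ (c1 v hvs)
    rw [hBu, dotProduct_sub, dotProduct_smul, smul_eq_mul]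
    linarith
  -- positivity of s
  obtain ⟨i, j, k, hij, hki, hkj⟩ := exists_triple G hG
  have hik : i ≠ k := fun h => hkj (h ▸ hij)
  have hjk : j ≠ k := fun h => hki (h ▸ hij.symm)
  have hne : i ≠ j := hij.ne
  have hs : 0 < μ 1 := by
    have := c1 (Pi.single i 1 + Pi.single j 1 - (2:ℝ) • Pi.single k 1)
      (by simp [Finset.sum_add_distrib, Finset.sum_sub_distrib, ← Finset.mul_sum]; norm_num)
    rw [hBu] at this
    have hki' : ¬ G.Adj i k := fun h => hki h.symm
    have hkj' : ¬ G.Adj j k := fun h => hkj h.symm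
    simp [Matrix.mulVec_add, Matrix.mulVec_sub, Matrix.mulVec_smul, add_dotProduct, sub_dotProduct,
      dotProduct_add, dotProduct_sub, hij, hij.symm, hki, hkj, hki', hkj', hik, hjk, hne,
      hik.symm, hjk.symm, hne.symm] at this
    linarith
  -- v in kernel of B
  have hn : (0:ℝ) < (d + 2 : ℕ) := by positivity
  have hvk : B *ᵥ v = 0 := by
    set g := B *ᵥ v with hg
    have hgs : ∑ i, g i = 0 := c2' v hvs hvB
    have hgg : 0 ≤ g ⬝ᵥ g := Finset.sum_nonneg fun i _ => mul_self_nonneg _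
    have hpoly : ∀ t : ℝ, 0 ≤ 2 * t * (g ⬝ᵥ g) + t^2 * (g ⬝ᵥ B *ᵥ g) := fun t => by
      have h4 := c1 (v + t • g) (by simp [Finset.sum_add_distrib, ← Finset.mul_sum, hvs, hgs])
      have h5 : v ⬝ᵥ B *ᵥ g = g ⬝ᵥ g := by rw [sym_dot hBh]
      rw [Matrix.mulVec_add, Matrix.mulVec_smul, ← hg, add_dotProduct, dotProduct_add,
        dotProduct_add, hvB] at h4
      simp only [dotProduct_smul, smul_dotProduct, smul_eq_mul, h5] at h4
      linarith
    have hgB := c1 g hgs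
    have : g ⬝ᵥ g = 0 := by
      by_contra hne
      have hgpos : 0 < g ⬝ᵥ g := lt_of_le_of_ne hgg (Ne.symm hne)
      have := hpoly (-(g ⬝ᵥ g) / (1 + g ⬝ᵥ B *ᵥ g))
      set x := g ⬝ᵥ g
      set z := g ⬝ᵥ B *ᵥ g
      have hz : 0 < 1 + z := by linarith
      have h6 : 2 * (-x / (1 + z)) * x + (-x / (1 + z))^2 * z = - x^2 * (2 + z) / (1+z)^2 := by
        field_simp; ring
      rw [h6] at this
      have h7 : 0 < x^2 * (2 + z) / (1+z)^2 := by positivity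
      have h8 : - x^2 * (2 + z) / (1+z)^2 = -(x^2 * (2 + z) / (1+z)^2) := by ring
      linarith
    exact dotProduct_self_eq_zero.1 this
  -- β and y
  have key : ∃ (β : ℝ) (y : Fin (d+2) → ℝ), ∑ i, y i ≠ 0 ∧ ∀ i, (B *ᵥ y) i + β * ∑ i, y i = 0 := by
    by_cases hker : ∀ z, B *ᵥ z = 0 → ∑ i, z i = 0
    · obtain ⟨y, hy⟩ := solve_one B hBh hker
      have hys : ∑ i, y i ≠ 0 := fun h0 => by
        have := c2' y h0 (by rw [hy]; simpa [dotProduct] using h0)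
        rw [hy] at this
        simp at this
        linarith
      refine ⟨-1 / ∑ i, y i, y, hys, fun i => ?_⟩
      rw [hy]; field_simp; ring
    · push Not at hker
      obtain ⟨z, hz, hzs⟩ := hker
      exact ⟨0, z, hzs, fun i => by simp [hz]⟩
  obtain ⟨β, y, hys, hy⟩ := key
  let M : Matrix (Fin (d+2)) (Fin (d+2)) ℝ := B + Matrix.of fun _ _ => β
  have hMu : ∀ u, M *ᵥ u = B *ᵥ u + fun _ => β * ∑ i, u i := fun u => by
    simp only [M, Matrix.add_mulVec]
    congr 1
    funext i
    simp [Matrix.mulVec, dotProduct, Finset.mul_sum]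
  have hMh : M.IsHermitian := hBh.add (by ext; simp)
  have hMv : M *ᵥ v = 0 := by rw [hMu, hvk, hvs]; funext; simp
  have hMy : M *ᵥ y = 0 := by rw [hMu]; funext i; exact hy i
  have hMp : M.PosSemidef := by
    refine Matrix.PosSemidef.of_dotProduct_mulVec_nonneg hMh fun u => ?_
    rw [star_trivial]
    set t := (∑ i, u i) / ∑ i, y i with ht
    set u' := u - t • y with hu'
    have hu's : ∑ i, u' i = 0 := by
      simp only [hu', Pi.sub_apply, Pi.smul_apply, smul_eq_mul, Finset.sum_sub_distrib, ← Finset.mul_sum, ht]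
      field_simp; ring
    have hu : u = u' + t • y := by simp [hu']
    have e1 : M *ᵥ u = M *ᵥ u' := by rw [hu, Matrix.mulVec_add, Matrix.mulVec_smul, hMy]; simp
    have e2 : M *ᵥ u' = B *ᵥ u' := by rw [hMu, hu's]; funext; simp
    have e3 : u ⬝ᵥ M *ᵥ u = u' ⬝ᵥ B *ᵥ u' := by
      rw [e1, sym_dot hMh, e1, e2]
    rw [e3]
    exact c1 u' hu's
  have hli : LinearIndependent ℝ ![v, y] := by
    rw [LinearIndependent.pair_iff]
    intro x z hxz
    have hsum : ∑ i, (x • v + z • y) i = 0 := by rw [hxz]; simp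
    simp only [Pi.add_apply, Pi.smul_apply, smul_eq_mul, Finset.sum_add_distrib, ← Finset.mul_sum, hvs] at hsum
    have hz : z = 0 := by simpa [hys] using hsum
    subst hz
    simp [hv0] at hxz
    exact ⟨hxz, rfl⟩
  obtain ⟨q, hq⟩ := gram_real d M hMp v y hMv hMy hli
  have hMe : ∀ i j, M i j = β + (μ 1 * if i = j then 1 else 0) - if G.Adj i j then 1 else 0 := fun i j => by
    simp [M, hB, Matrix.one_apply]; ring
  have hd : ∀ i j, i ≠ j → dist (q i) (q j) = √(2 * μ 1 + if G.Adj i j then 2 else 0) := fun i j hij => by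
    rw [dist_eq_norm, eq_comm, Real.sqrt_eq_iff_mul_self_eq (by split_ifs <;> linarith) (norm_nonneg _)]
    have := norm_sub_sq_real (q i) (q j)
    rw [← real_inner_self_eq_norm_sq (q i), ← real_inner_self_eq_norm_sq (q j), hq, hq, hq, hMe, hMe, hMe] at this
    simp [hij] at this
    rw [← sq, this]
    split_ifs <;> ring
  refine ⟨_, q, 0, √(β + μ 1), ⟨√(2 * μ 1 + 2), √(2 * μ 1), ?_, ?_, rfl, ?_, ?_, ⟨i, j, hij⟩, ⟨i, k, hik, fun h => hki h.symm⟩⟩, ?_⟩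
  · exact Real.sqrt_lt_sqrt (by linarith) (by linarith)
  · exact Real.sqrt_pos.2 (by linarith)
  · intro i j hij
    rw [hd i j hij.ne, if_pos hij]
  · intro i j hij hn
    rw [hd i j hij, if_neg hn, add_zero]
  · intro i
    rw [dist_zero_right, norm_eq_sqrt_real_inner, hq, hMe]
    simp


/-- **Lemma 13.** Let `G` on `d+2` vertices be not complete multipartite and
`B̄ = λ₂·I - A_G`. Then `G` is spherical in `ℝ^d` iff `wᵀ B̄ w ≥ 0` for every
`w ∈ 𝟙^⊥` and `𝟙ᵀ A_G w = 0` for every `w ∈ 𝟙^⊥` with `wᵀ B̄ w = 0`. -/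
theorem stmt15 (d : ℕ) (G : SimpleGraph (Fin (d+2))) [DecidableRel G.Adj]
    (hG : ¬ IsCompleteMultipartite G)
    (hA : (G.adjMatrix ℝ).IsHermitian)
    (μ : Fin (d+2) → ℝ) (hmono : Antitone μ)
    (hperm : ∃ σ : Equiv.Perm (Fin (d+2)), μ = hA.eigenvalues ∘ σ)
    (Bbar : Matrix (Fin (d+2)) (Fin (d+2)) ℝ)
    (hB : Bbar = μ 1 • (1 : Matrix (Fin (d+2)) (Fin (d+2)) ℝ) - G.adjMatrix ℝ) :
    Spherical (d+2) d G ↔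
      ((∀ w : Fin (d+2) → ℝ, (∑ i, w i) = 0 → 0 ≤ w ⬝ᵥ Bbar.mulVec w) ∧
       (∀ w : Fin (d+2) → ℝ, (∑ i, w i) = 0 → w ⬝ᵥ Bbar.mulVec w = 0 →
          (fun _ => (1 : ℝ)) ⬝ᵥ (G.adjMatrix ℝ).mulVec w = 0)) := by
  have hBw : ∀ w, w ⬝ᵥ Bbar *ᵥ w = μ 1 * (w ⬝ᵥ w) - w ⬝ᵥ (G.adjMatrix ℝ) *ᵥ w := fun w => by
    rw [hB, Matrix.sub_mulVec, Matrix.smul_mulVec, Matrix.one_mulVec, dotProduct_sub,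
      dotProduct_smul, smul_eq_mul]
  constructor
  · intro h
    have := fwd d G hA μ hmono hperm h
    simp only [hBw]
    exact this
  · rintro ⟨c1, c2⟩
    exact bwd d G hG hA μ hmono hperm Bbar hB c1 c2
end

section
/- If G is a regular graph on d+2 vertices that is not complete multipartite, then G has a spherical representation in ℝ^d. -/
open Matrix Finset
open scoped Classical

open Matrix Finset in
lemma exists_max_rayleigh {n : ℕ} (A : Matrix (Fin n) (Fin n) ℝ) (x0 : Fin n → ℝ)
    (hs : ∑ i, x0 i = 0) (hpos : 0 < x0 ⬝ᵥ (A *ᵥ x0)) :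
    ∃ (θ : ℝ) (v : Fin n → ℝ), 0 < θ ∧ v ≠ 0 ∧ ∑ i, v i = 0 ∧
      v ⬝ᵥ (A *ᵥ v) = θ * (v ⬝ᵥ v) ∧
      ∀ x : Fin n → ℝ, ∑ i, x i = 0 → x ⬝ᵥ (A *ᵥ x) ≤ θ * (x ⬝ᵥ x) := by
  let K : Set (Fin n → ℝ) := {x | ∑ i, x i = 0 ∧ x ⬝ᵥ x = 1}
  have hK : IsCompact K := by
    apply Metric.isCompact_of_isClosed_isBounded
    · apply IsClosed.inter
      · exact isClosed_eq (by fun_prop) (by fun_prop)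
      · exact isClosed_eq (by unfold dotProduct; fun_prop) (by fun_prop)
    · apply (Metric.isBounded_closedBall (x := (0 : Fin n → ℝ)) (r := 1)).subset
      rintro x ⟨_, hx⟩
      rw [mem_closedBall_zero_iff, pi_norm_le_iff_of_nonneg zero_le_one]
      intro i
      have h : x i * x i ≤ x ⬝ᵥ x :=
        Finset.single_le_sum (f := fun i => x i * x i)
          (fun i _ => mul_self_nonneg _) (Finset.mem_univ i)
      rw [Real.norm_eq_abs, abs_le]
      constructor <;> nlinarith
  have key : ∀ x : Fin n → ℝ, x ≠ 0 → ∑ i, x i = 0 →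
      ∃ y ∈ K, x ⬝ᵥ (A *ᵥ x) = (y ⬝ᵥ (A *ᵥ y)) * (x ⬝ᵥ x) := by
    intro x hx hsx
    have h0 : 0 < x ⬝ᵥ x := by
      have h1 : x ⬝ᵥ x ≠ 0 := fun h => hx (dotProduct_self_eq_zero.1 h)
      have h2 : 0 ≤ x ⬝ᵥ x := Finset.sum_nonneg fun i _ => mul_self_nonneg _
      exact lt_of_le_of_ne h2 h1.symm
    have hq : Real.sqrt (x ⬝ᵥ x) * Real.sqrt (x ⬝ᵥ x) = x ⬝ᵥ x := Real.mul_self_sqrt h0.le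
    have hq0 : Real.sqrt (x ⬝ᵥ x) ≠ 0 := (Real.sqrt_pos.2 h0).ne'
    refine ⟨(Real.sqrt (x ⬝ᵥ x))⁻¹ • x, ⟨?_, ?_⟩, ?_⟩
    · simp only [Pi.smul_apply, smul_eq_mul, ← Finset.mul_sum, hsx, mul_zero]
    · rw [smul_dotProduct, dotProduct_smul, smul_eq_mul, smul_eq_mul]
      nth_rewrite 3 [← hq]
      field_simp
    · rw [mulVec_smul, smul_dotProduct, dotProduct_smul, smul_eq_mul, smul_eq_mul]
      generalize x ⬝ᵥ (A *ᵥ x) = t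
      generalize Real.sqrt (x ⬝ᵥ x) = s at hq hq0
      rw [← hq]
      field_simp
  have hx0 : x0 ≠ 0 := by
    rintro rfl
    simp at hpos
  obtain ⟨y0, hy0, hy0'⟩ := key x0 hx0 hs
  have hc : ContinuousOn (fun x : Fin n → ℝ => x ⬝ᵥ (A *ᵥ x)) K := by
    apply Continuous.continuousOn
    unfold Matrix.mulVec dotProduct
    fun_prop
  obtain ⟨v, hv, hmax⟩ := hK.exists_isMaxOn ⟨y0, hy0⟩ hc
  have nn : ∀ x : Fin n → ℝ, 0 ≤ x ⬝ᵥ x :=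
    fun x => Finset.sum_nonneg fun i _ => mul_self_nonneg _
  refine ⟨v ⬝ᵥ (A *ᵥ v), v, ?_, ?_, hv.1, ?_, ?_⟩
  · have h1 : y0 ⬝ᵥ (A *ᵥ y0) ≤ v ⬝ᵥ (A *ᵥ v) := hmax hy0
    have h2 : 0 < y0 ⬝ᵥ (A *ᵥ y0) := by
      by_contra h
      have := nn x0
      nlinarith
    linarith
  · rintro rfl
    have := hv.2
    simp at this
  · rw [hv.2, mul_one]
  · intro x hx
    by_cases h : x = 0
    · subst h; simp
    · obtain ⟨y, hy, hy'⟩ := key x h hx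
      rw [hy']
      exact mul_le_mul_of_nonneg_right (hmax hy) (nn x)

open Matrix Finset in
open scoped MatrixOrder in
lemma exists_gram {d : ℕ} (M : Matrix (Fin (d+2)) (Fin (d+2)) ℝ) (hM : M.PosSemidef)
    (v : Fin (d+2) → ℝ) (hv : v ≠ 0) (hvs : ∑ i, v i = 0)
    (h1 : M *ᵥ (fun _ => 1) = 0) (h2 : M *ᵥ v = 0) :
    ∃ p : Fin (d+2) → EuclideanSpace ℝ (Fin d), ∀ i j, inner ℝ (p i) (p j) = M i j := by
  let B := CFC.sqrt M
  have hBB : B * B = M := CFC.sqrt_mul_sqrt_self M hM.nonneg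
  have hBp : B.PosSemidef := (Matrix.nonneg_iff_posSemidef).1 (CFC.sqrt_nonneg M)
  have hBT : Bᵀ = B := by
    have := hBp.1
    simpa [Matrix.IsHermitian] using this
  have hker : ∀ w, M *ᵥ w = 0 → B *ᵥ w = 0 := by
    intro w hw
    have h : (B *ᵥ w) ⬝ᵥ (B *ᵥ w) = 0 := by
      nth_rewrite 1 [← hBT]
      rw [mulVec_transpose, ← dotProduct_mulVec, mulVec_mulVec, hBB, hw, dotProduct_zero]
    exact dotProduct_self_eq_zero.1 h
  have hB1 := hker _ h1
  have hB2 := hker _ h2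
  let e : Fin 2 → EuclideanSpace ℝ (Fin (d+2)) :=
    ![WithLp.toLp 2 (fun _ => 1), WithLp.toLp 2 v]
  have hli : LinearIndependent ℝ e := by
    apply linearIndependent_of_ne_zero_of_inner_eq_zero
    · intro i
      fin_cases i
      · intro h
        have := congrArg (fun z : EuclideanSpace ℝ (Fin (d+2)) => z 0) h
        simp [e] at this
      · simpa [e] using hv
    · intro i j hij
      fin_cases i <;> fin_cases j
      · exact absurd rfl hij
      · simpa [e, PiLp.inner_apply] using hvs
      · simpa [e, PiLp.inner_apply] using hvs
      · exact absurd rfl hij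
  let T := (Submodule.span ℝ (Set.range e))ᗮ
  have hT : Module.finrank ℝ T = d := by
    have h := Submodule.finrank_add_finrank_orthogonal (Submodule.span ℝ (Set.range e))
    rw [finrank_span_eq_card hli] at h
    simp at h
    change Module.finrank ℝ (Submodule.span ℝ (Set.range e))ᗮ = d
    omega
  have hmem : ∀ i, (WithLp.toLp 2 (B i) : EuclideanSpace ℝ (Fin (d+2))) ∈ T := by
    intro i
    rw [Submodule.mem_orthogonal]
    intro u hu
    induction hu using Submodule.span_induction with
    | mem x hx =>
      obtain ⟨k, rfl⟩ := hx
      fin_cases k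
      · have := congrFun hB1 i
        simpa [e, PiLp.inner_apply, mulVec, dotProduct] using this
      · have := congrFun hB2 i
        simpa [e, PiLp.inner_apply, mulVec, dotProduct] using this
    | zero => simp
    | add x y _ _ hx hy => rw [inner_add_left, hx, hy, add_zero]
    | smul a x _ hx => rw [inner_smul_left, hx, mul_zero]
  let b := (stdOrthonormalBasis ℝ T).reindex (finCongr hT)
  refine ⟨fun i => b.repr ⟨_, hmem i⟩, fun i j => ?_⟩
  rw [LinearIsometryEquiv.inner_map_map, Submodule.coe_inner, ← hBB]
  simp only [PiLp.inner_apply, Matrix.mul_apply]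
  refine Finset.sum_congr rfl fun k _ => ?_
  have : B j k = B k j := congrFun (congrFun hBT k) j
  simp [← this, mul_comm]

/-- **Corollary 15.** A regular graph on `d+2` vertices that is not complete
multipartite has a spherical representation in `ℝ^d`. -/
theorem stmt17 (d : ℕ) (G : SimpleGraph (Fin (d+2))) [DecidableRel G.Adj]
    (hreg : ∃ r : ℕ, G.IsRegularOfDegree r)
    (hG : ¬ IsCompleteMultipartite G) :
    Spherical (d+2) d G := by
  obtain ⟨r, hr⟩ := hreg
  -- nonadjacency is not transitive
  have hex : ∃ i j k, G.Adj i j ∧ ¬ G.Adj i k ∧ ¬ G.Adj k j := by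
    by_contra hcon
    push Not at hcon
    apply hG
    let S : Setoid (Fin (d+2)) :=
      ⟨fun i j => ¬ G.Adj i j, fun i => G.loopless.irrefl i, fun h h' => h h'.symm,
        fun {x y z} h h' hxz => h' (hcon x z y hxz h)⟩
    refine ⟨fun i => (Quotient.mk S i).out, fun i j => ?_⟩
    rw [ne_eq, Quotient.out_inj, Quotient.eq]
    change _ ↔ ¬ ¬ _
    rw [not_not]
  obtain ⟨i, j, k, hij, hik, hkj⟩ := hex
  have hneij : i ≠ j := hij.ne
  have hneik : i ≠ k := by rintro rfl; exact hkj hij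
  have hnekj : k ≠ j := by rintro rfl; exact hik hij
  let A : Matrix (Fin (d+2)) (Fin (d+2)) ℝ := G.adjMatrix ℝ
  have hA : ∀ a b, A a b = if G.Adj a b then 1 else 0 := fun a b => by
    simp [A, SimpleGraph.adjMatrix_apply]
  let x0 : Fin (d+2) → ℝ := Pi.single i 1 + Pi.single j 1 - (2:ℝ) • Pi.single k 1
  have hx0 : ∑ a, x0 a = 0 := by
    simp only [x0, Pi.sub_apply, Pi.add_apply, Pi.smul_apply, Finset.sum_sub_distrib,
      Finset.sum_add_distrib, ← Finset.smul_sum, Finset.sum_pi_single', Finset.mem_univ]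
    norm_num
  have hx0A : 0 < x0 ⬝ᵥ (A *ᵥ x0) := by
    have hjk : ¬ G.Adj j k := fun h => hkj h.symm
    have hki : ¬ G.Adj k i := fun h => hik h.symm
    have : x0 ⬝ᵥ (A *ᵥ x0) = 2 := by
      simp only [x0, mulVec_sub, mulVec_add, mulVec_smul, sub_dotProduct, add_dotProduct,
        smul_dotProduct, single_dotProduct, mulVec_single_one, Pi.sub_apply, Pi.add_apply,
        Pi.smul_apply, col_apply, hA]
      simp [hij, hij.symm, hik, hkj, hjk, hki]
      norm_num
    rw [this]; norm_num
  obtain ⟨θ, v, hθ, hv, hvs, hvA, hmax⟩ := exists_max_rayleigh A x0 hx0 hx0A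
  have hA1 : A *ᵥ (fun _ => 1) = fun _ => (r : ℝ) := by
    funext a
    have := SimpleGraph.adjMatrix_mulVec_const_apply_of_regular (α := ℝ) hr (a := 1) (v := a)
    simpa [A, Function.const_def] using this
  let c : ℝ := (r - θ) / (d + 2)
  let M : Matrix (Fin (d+2)) (Fin (d+2)) ℝ := θ • 1 - A + c • Matrix.of fun _ _ => 1
  have hJ : ∀ x : Fin (d+2) → ℝ,
      (Matrix.of fun _ _ => (1:ℝ) : Matrix (Fin (d+2)) (Fin (d+2)) ℝ) *ᵥ x =
        fun _ => ∑ i, x i := by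
    intro x; funext a; simp [mulVec, dotProduct]
  have hMx : ∀ x, M *ᵥ x = θ • x - A *ᵥ x + c • fun _ => ∑ i, x i := by
    intro x
    simp only [M, add_mulVec, sub_mulVec, smul_mulVec, one_mulVec, hJ]
  have hd : ((d : ℝ) + 2) ≠ 0 := by positivity
  have hM1 : M *ᵥ (fun _ => 1) = 0 := by
    rw [hMx, hA1]
    funext a
    simp [c]
    field_simp
    ring
  have hMT : Mᵀ = M := by
    ext a b
    simp [M, hA, Matrix.one_apply, G.adj_comm a b, eq_comm (a := a) (b := b)]
  have hMq : ∀ x : Fin (d+2) → ℝ, ∑ i, x i = 0 →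
      x ⬝ᵥ (M *ᵥ x) = θ * (x ⬝ᵥ x) - x ⬝ᵥ (A *ᵥ x) := by
    intro x hx
    rw [hMx, hx, dotProduct_add, dotProduct_sub, dotProduct_smul]
    have : (c • fun _ : Fin (d+2) => (0:ℝ)) = 0 := by ext; simp
    rw [this, dotProduct_zero]; simp
  have h1M : ∀ x, (fun _ => (1:ℝ)) ⬝ᵥ (M *ᵥ x) = 0 := by
    intro x
    rw [dotProduct_mulVec, ← mulVec_transpose, hMT, hM1, zero_dotProduct]
  have hMp : M.PosSemidef := by
    apply Matrix.PosSemidef.of_dotProduct_mulVec_nonneg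
    · simpa [Matrix.IsHermitian] using hMT
    · intro x
      let m : ℝ := (∑ i, x i) / (d + 2)
      let u : Fin (d+2) → ℝ := x - m • fun _ => 1
      have hu : ∑ i, u i = 0 := by
        simp [u, m, Finset.sum_sub_distrib]
        field_simp
        ring
      have hxu : x = u + m • fun _ => 1 := by simp [u]
      have : x ⬝ᵥ (M *ᵥ x) = u ⬝ᵥ (M *ᵥ u) := by
        rw [hxu, mulVec_add, mulVec_smul, hM1, smul_zero, add_zero, add_dotProduct,
          smul_dotProduct, h1M, smul_zero, add_zero]
      rw [star_trivial, this, hMq u hu]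
      linarith [hmax u hu]
  have hMv : M *ᵥ v = 0 := by
    rw [← hMp.dotProduct_mulVec_zero_iff, star_trivial, hMq v hvs, hvA, sub_self]
  obtain ⟨p, hp⟩ := exists_gram M hMp v hv hvs hM1 hMv
  have hdiag : ∀ a, M a a = θ + c := by
    intro a; simp [M, hA]
  have hdist : ∀ a b, dist (p a) (p b) = Real.sqrt (2 * (θ + c) - 2 * M a b) := by
    intro a b
    rw [dist_eq_norm, ← Real.sqrt_sq (norm_nonneg (p a - p b)), norm_sub_sq_real,
      ← real_inner_self_eq_norm_sq, ← real_inner_self_eq_norm_sq, hp, hp, hp, hdiag, hdiag]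
    congr 1; ring
  refine ⟨_, p, 0, Real.sqrt (θ + c),
    ⟨Real.sqrt (2 * θ + 2), Real.sqrt (2 * θ), ?_, ?_, rfl, ?_, ?_, ⟨i, j, hij⟩,
      ⟨i, k, hneik, hik⟩⟩, ?_⟩
  · exact Real.sqrt_lt_sqrt (by positivity) (by linarith)
  · exact Real.sqrt_pos.2 (by positivity)
  · intro a b hab
    rw [hdist]
    congr 1
    simp [M, hA, hab, Matrix.one_apply, hab.ne]
    ring
  · intro a b hne hab
    rw [hdist]
    congr 1
    simp [M, hA, hab, Matrix.one_apply, hne]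
    ring
  · intro a
    rw [dist_zero_right, ← Real.sqrt_sq (norm_nonneg (p a)), ← real_inner_self_eq_norm_sq,
      hp, hdiag]
end

section
/- Let G be a graph on n vertices (n ≥ 3) that has a spherical representation in ℝ^{n−2}, let λ₁ ≥ λ₂ ≥ … ≥ λₙ be the eigenvalues of its adjacency matrix A_G, and let k be the largest index such that λ_k = λ₂. Then the smallest dimension m for which G is representable in ℝ^m is m = n − k. -/
open Matrix Finset
open scoped Classical

open scoped InnerProductSpace

theorem core {E ι : Type*} [NormedAddCommGroup E] [InnerProductSpace ℝ E] [FiniteDimensional ℝ E]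
    [Fintype ι] (b : OrthonormalBasis ι ℝ E) (L : E →ₗ[ℝ] E) (l : ι → ℝ)
    (hL : ∀ i, L (b i) = l i • b i) (φ : E →ₗ[ℝ] ℝ) (t : ℝ)
    (h1 : ∀ x, φ x = 0 → ⟪x, L x⟫_ℝ ≤ t * ‖x‖ ^ 2)
    (h2 : ∀ x, φ x = 0 → ⟪x, L x⟫_ℝ = t * ‖x‖ ^ 2 → L x = t • x)
    (h3 : ∃ x, x ≠ 0 ∧ φ x = 0 ∧ L x = t • x)
    (h4 : ∀ v, v ≠ 0 → ∃ u, ‖u‖ = ‖v‖ ∧ ⟪v, L v⟫_ℝ ≤ ⟪u, L u⟫_ℝ ∧ φ u ≠ 0) :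
    (Finset.univ.filter (fun i => t ≤ l i)).card
      = Module.finrank ℝ ↥(LinearMap.ker φ ⊓ LinearMap.ker (L - t • LinearMap.id)) + 1 ∧
    (Finset.univ.filter (fun i => t < l i)).card ≤ 1 := by
  have hc : ∀ x i, ⟪b i, L x⟫_ℝ = l i * ⟪b i, x⟫_ℝ := by
    intro x i
    conv_lhs => rw [← b.sum_repr x]
    rw [map_sum, inner_sum, Finset.sum_eq_single i]
    · rw [map_smul, hL, inner_smul_right, inner_smul_right, b.repr_apply_apply,
        real_inner_self_eq_norm_sq, b.norm_eq_one]
      ring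
    · intro j _ hj
      rw [map_smul, hL, inner_smul_right, inner_smul_right, b.inner_eq_zero hj.symm]
      ring
    · simp
  have hq : ∀ x, ⟪x, L x⟫_ℝ = ∑ i, l i * ⟪b i, x⟫_ℝ ^ 2 := by
    intro x
    rw [← b.sum_inner_mul_inner]
    refine Finset.sum_congr rfl fun i _ => ?_
    rw [hc, real_inner_comm]; ring
  have hn : ∀ x, ‖x‖ ^ 2 = ∑ i, ⟪b i, x⟫_ℝ ^ 2 := by
    intro x
    rw [← real_inner_self_eq_norm_sq, ← b.sum_inner_mul_inner]
    refine Finset.sum_congr rfl fun i _ => ?_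
    rw [real_inner_comm]; ring
  have hd : ∀ x, ⟪x, L x⟫_ℝ - t * ‖x‖ ^ 2 = ∑ i, (l i - t) * ⟪b i, x⟫_ℝ ^ 2 := by
    intro x
    rw [hq, hn, Finset.mul_sum, ← Finset.sum_sub_distrib]
    refine Finset.sum_congr rfl fun i _ => ?_
    ring
  -- spans
  let W : Set ι → Submodule ℝ E := fun s => Submodule.span ℝ (b '' s)
  have hW : ∀ s x, x ∈ W s ↔ ∀ i, i ∉ s → ⟪b i, x⟫_ℝ = 0 := by
    intro s x
    have := b.toBasis.mem_span_image (m := x) (s := s)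
    simp only [W]
    rw [OrthonormalBasis.coe_toBasis] at this
    rw [this, Set.subset_def]
    refine forall_congr' fun i => ?_
    rw [Finset.mem_coe, Finsupp.mem_support_iff, OrthonormalBasis.coe_toBasis_repr_apply,
      b.repr_apply_apply]
    tauto
  have hWd : ∀ s : Finset ι, Module.finrank ℝ (W ↑s) = s.card := by
    intro s
    have h := finrank_span_finset_eq_card (R := ℝ) (s := s.image b) (by
      have := b.toBasis.linearIndependent.linearIndepOn_id.mono (s := Set.range b.toBasis) (t := b '' s) (by
        rw [OrthonormalBasis.coe_toBasis]; exact Set.image_subset_range _ _)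
      rw [Finset.coe_image]
      exact this)
    rw [Finset.coe_image] at h
    simp only [W]
    rw [h, Finset.card_image_of_injective]
    have := b.toBasis.injective
    rwa [OrthonormalBasis.coe_toBasis] at this
  -- kernel intersections
  have hker : ∀ U : Submodule ℝ E, Module.finrank ℝ U ≤
      Module.finrank ℝ ↥(LinearMap.ker φ ⊓ U) + 1 ∧
      ((∃ u ∈ U, φ u ≠ 0) → Module.finrank ℝ ↥(LinearMap.ker φ ⊓ U) + 1 ≤ Module.finrank ℝ U) := by
    intro U
    have e1 := LinearMap.finrank_range_add_finrank_ker (φ.domRestrict U)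
    have e2 : Module.finrank ℝ (LinearMap.ker (φ.domRestrict U)) =
        Module.finrank ℝ ↥(LinearMap.ker φ ⊓ U) := by
      have : (LinearMap.ker (φ.domRestrict U)).map U.subtype = LinearMap.ker φ ⊓ U := by
        ext x; simp [LinearMap.domRestrict_apply]
        
      rw [← this, LinearEquiv.finrank_eq (Submodule.equivMapOfInjective _ U.injective_subtype _)]
    have e3 : Module.finrank ℝ (LinearMap.range (φ.domRestrict U)) ≤ 1 := by
      simpa using Submodule.finrank_le (LinearMap.range (φ.domRestrict U))
    refine ⟨by omega, ?_⟩
    rintro ⟨u, hu, hu0⟩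
    have : 0 < Module.finrank ℝ (LinearMap.range (φ.domRestrict U)) := by
      rw [Module.finrank_pos_iff_exists_ne_zero]
      exact ⟨⟨φ u, ⟨⟨u, hu⟩, rfl⟩⟩, fun h => hu0 (congrArg Subtype.val h)⟩
    omega
  constructor
  · set s := Finset.univ.filter (fun i => t ≤ l i) with hs
    have hmem : ∀ i, i ∉ (↑s : Set ι) ↔ l i < t := by intro i; simp [hs]
    have hge : ∀ x ∈ W s, t * ‖x‖ ^ 2 ≤ ⟪x, L x⟫_ℝ := by
      intro x hx
      rw [← sub_nonneg, hd]
      refine Finset.sum_nonneg fun i _ => ?_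
      by_cases hi : t ≤ l i
      · exact mul_nonneg (sub_nonneg.2 hi) (sq_nonneg _)
      · rw [(hW _ _).1 hx i ((hmem i).2 (not_le.1 hi))]; simp
    have hEW : ∀ x, L x = t • x → x ∈ W s := by
      intro x hx
      rw [hW]
      intro i hi
      rw [hmem] at hi
      have := hc x i
      rw [hx, inner_smul_right] at this
      have : (t - l i) * ⟪b i, x⟫_ℝ = 0 := by linarith
      rcases mul_eq_zero.1 this with h | h
      · linarith
      · exact h
    have heq : LinearMap.ker φ ⊓ LinearMap.ker (L - t • LinearMap.id) = LinearMap.ker φ ⊓ W s := by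
      ext x
      simp only [Submodule.mem_inf, LinearMap.mem_ker, LinearMap.sub_apply, LinearMap.smul_apply,
        LinearMap.id_apply, sub_eq_zero]
      constructor
      · rintro ⟨a, c⟩; exact ⟨a, hEW x c⟩
      · rintro ⟨a, c⟩; exact ⟨a, h2 x a (le_antisymm (h1 x a) (hge x c))⟩
    rw [heq, ← hWd]
    refine le_antisymm (hker _).1 ((hker _).2 ?_)
    by_contra! hcon
    obtain ⟨x, hx0, hxφ, hx⟩ := h3
    have hle : ∀ i, l i ≤ t := by
      intro i
      by_contra! hi
      have hb : b i ∈ W s := Submodule.subset_span ⟨i, by simp [hs, hi.le], rfl⟩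
      have := h1 _ (hcon _ hb)
      rw [hL, inner_smul_right, real_inner_self_eq_norm_sq, b.norm_eq_one] at this
      linarith
    obtain ⟨u, hu1, hu2, hu3⟩ := h4 x hx0
    refine hu3 (hcon u ?_)
    rw [hW]
    intro i hi
    rw [hmem] at hi
    rw [hx, inner_smul_right, real_inner_self_eq_norm_sq, ← hu1] at hu2
    have hsum := hd u
    have : ∑ i, (t - l i) * ⟪b i, u⟫_ℝ ^ 2 ≤ 0 := by
      have e : ∑ i, (t - l i) * ⟪b i, u⟫_ℝ ^ 2 = - ∑ i, (l i - t) * ⟪b i, u⟫_ℝ ^ 2 := by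
        rw [← Finset.sum_neg_distrib]
        exact Finset.sum_congr rfl fun i _ => by ring
      linarith
    have hnn : ∀ i ∈ Finset.univ, 0 ≤ (t - l i) * ⟪b i, u⟫_ℝ ^ 2 := fun i _ =>
      mul_nonneg (sub_nonneg.2 (hle i)) (sq_nonneg _)
    have h0 := (Finset.sum_eq_zero_iff_of_nonneg hnn).1 (le_antisymm this (Finset.sum_nonneg hnn)) i
      (Finset.mem_univ _)
    rcases mul_eq_zero.1 h0 with h | h
    · linarith
    · exact pow_eq_zero_iff (two_ne_zero) |>.1 h
  · set s := Finset.univ.filter (fun i => t < l i) with hs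
    have hmem : ∀ i, i ∉ (↑s : Set ι) ↔ l i ≤ t := by intro i; simp [hs]
    rw [← hWd]
    refine (hker _).1.trans ?_
    have : LinearMap.ker φ ⊓ W s = ⊥ := by
      rw [eq_bot_iff]
      rintro x ⟨hx1, hx2⟩
      have hx1 : φ x = 0 := hx1
      have hz := hd x
      have hle := h1 x hx1
      have hnn : ∀ i ∈ Finset.univ, 0 ≤ (l i - t) * ⟪b i, x⟫_ℝ ^ 2 := by
        intro i _
        by_cases hi : t < l i
        · exact mul_nonneg (sub_nonneg.2 hi.le) (sq_nonneg _)
        · rw [(hW _ _).1 hx2 i ((hmem i).2 (not_lt.1 hi))]; simp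
      have hz0 : ∑ i, (l i - t) * ⟪b i, x⟫_ℝ ^ 2 = 0 :=
        le_antisymm (by linarith) (Finset.sum_nonneg hnn)
      have h0 := (Finset.sum_eq_zero_iff_of_nonneg hnn).1 hz0
      have : ‖x‖ ^ 2 = 0 := by
        rw [hn]
        refine Finset.sum_eq_zero fun i _ => ?_
        by_cases hi : t < l i
        · rcases mul_eq_zero.1 (h0 i (Finset.mem_univ _)) with h | h
          · linarith
          · exact h
        · rw [(hW _ _).1 hx2 i ((hmem i).2 (not_lt.1 hi))]; simp
      simpa using this
    rw [this]; simp

theorem sorted_count (N : ℕ) (μ : Fin (N+3) → ℝ) (hmono : Antitone μ)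
    (K : Fin (N+3)) (hK : IsGreatest {i : Fin (N+3) | μ i = μ 1} K) (t : ℝ) (d : ℕ) (hd : 1 ≤ d)
    (h1 : (Finset.univ.filter (fun i => t ≤ μ i)).card = d + 1)
    (h2 : (Finset.univ.filter (fun i => t < μ i)).card ≤ 1) : (K : ℕ) = d := by
  have h01 : (0 : Fin (N+3)) ≠ 1 := by simp [Fin.ext_iff]
  have a1 : t ≤ μ 1 := by
    by_contra! h
    have : Finset.univ.filter (fun i => t ≤ μ i) ⊆ {0} := by
      intro i hi
      simp only [Finset.mem_filter, Finset.mem_univ, true_and] at hi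
      rw [Finset.mem_singleton]
      by_contra hi0
      have : (1 : Fin (N+3)) ≤ i := Fin.one_le_of_ne_zero hi0
      linarith [hmono this]
    have := Finset.card_le_card this
    simp at this
    omega
  have a2 : μ 1 ≤ t := by
    by_contra! h
    have : ({0, 1} : Finset (Fin (N+3))) ⊆ Finset.univ.filter (fun i => t < μ i) := by
      intro i hi
      simp only [Finset.mem_filter, Finset.mem_univ, true_and]
      have : i ≤ 1 := by
        simp only [Finset.mem_insert, Finset.mem_singleton] at hi
        rcases hi with rfl | rfl <;> simp
      linarith [hmono this]
    have := Finset.card_le_card this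
    rw [Finset.card_pair h01] at this
    omega
  have a3 : μ 1 = t := le_antisymm a2 a1
  have hK1 : μ K = t := by rw [← a3]; exact hK.1
  have : Finset.univ.filter (fun i => t ≤ μ i) = Finset.Iic K := by
    ext i
    simp only [Finset.mem_filter, Finset.mem_univ, true_and, Finset.mem_Iic]
    constructor
    · intro hi
      by_contra! hlt
      have : μ i ≤ t := hK1 ▸ hmono hlt.le
      have : i ≤ K := hK.2 (show μ i = μ 1 by rw [a3]; exact le_antisymm this hi)
      exact absurd this (not_le.2 hlt)
    · intro hi
      exact hK1 ▸ hmono hi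
  rw [this, Fin.card_Iic] at h1
  omega

/-- weighted-sum map attached to a point configuration -/
noncomputable def Tmap {n d : ℕ} (p : Fin n → EuclideanSpace ℝ (Fin d)) :
    EuclideanSpace ℝ (Fin n) →ₗ[ℝ] EuclideanSpace ℝ (Fin d) where
  toFun x := ∑ i, x i • p i
  map_add' x y := by simp [add_smul, Finset.sum_add_distrib]
  map_smul' c x := by simp [mul_smul, Finset.smul_sum]

/-- coordinate sum -/
noncomputable def phi (n : ℕ) : EuclideanSpace ℝ (Fin n) →ₗ[ℝ] ℝ where
  toFun x := ∑ i, x i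
  map_add' x y := by simp [Finset.sum_add_distrib]
  map_smul' c x := by simp [Finset.mul_sum]

theorem Tmap_apply {n d : ℕ} (p : Fin n → EuclideanSpace ℝ (Fin d)) (x) :
    Tmap p x = ∑ i, x i • p i := rfl
theorem phi_apply {n : ℕ} (x) : phi n x = ∑ i, x i := rfl

theorem rep_form {n d : ℕ} {G : SimpleGraph (Fin n)} [DecidableRel G.Adj] {k : ℝ}
    {p : Fin n → EuclideanSpace ℝ (Fin d)} (h : IsTwoDistRep n d G k p) :
    ∃ a b : ℝ, 0 < a ∧ 0 < b ∧ ∀ i j, dist (p i) (p j) ^ 2 =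
      b * (if i = j then 0 else 1) + a * G.adjMatrix ℝ i j := by
  obtain ⟨α₁, α₂, h12, h2, -, hadj, hnadj, -, -⟩ := h
  refine ⟨α₁ ^ 2 - α₂ ^ 2, α₂ ^ 2, by nlinarith, by positivity, ?_⟩
  intro i j
  by_cases hij : i = j
  · subst hij; simp
  · by_cases ha : G.Adj i j
    · rw [hadj i j ha]; simp [hij, SimpleGraph.adjMatrix_apply, ha]
    · rw [hnadj i j hij ha]; simp [hij, SimpleGraph.adjMatrix_apply, ha]

theorem adjLin_apply {n : ℕ} (A : Matrix (Fin n) (Fin n) ℝ) (x : EuclideanSpace ℝ (Fin n)) (i) :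
    Matrix.toEuclideanLin A x i = ∑ j, A i j * x j := by
  rw [Matrix.ofLp_toEuclideanLin_apply]; rfl

theorem inner_L {n : ℕ} (A : Matrix (Fin n) (Fin n) ℝ) (x : EuclideanSpace ℝ (Fin n)) :
    ⟪x, Matrix.toEuclideanLin A x⟫_ℝ = ∑ i, ∑ j, x i * x j * A i j := by
  rw [PiLp.inner_apply]
  refine Finset.sum_congr rfl fun i _ => ?_
  rw [adjLin_apply, real_inner_eq_re_inner]
  simp only [RCLike.inner_apply, conj_trivial, Finset.sum_mul]
  simp only [RCLike.re_to_real]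
  exact Finset.sum_congr rfl fun j _ => by ring

theorem D_mul {n d : ℕ} {A : Matrix (Fin n) (Fin n) ℝ} {a b : ℝ}
    {p : Fin n → EuclideanSpace ℝ (Fin d)}
    (h : ∀ i j, dist (p i) (p j) ^ 2 = b * (if i = j then 0 else 1) + a * A i j)
    (x : EuclideanSpace ℝ (Fin n)) (hx : phi n x = 0) (i : Fin n) :
    ∑ j, dist (p i) (p j) ^ 2 * x j = - b * x i + a * Matrix.toEuclideanLin A x i := by
  rw [phi_apply] at hx
  have : ∀ j, dist (p i) (p j) ^ 2 * x j
      = b * x j - (if i = j then b * x j else 0) + a * (A i j * x j) := by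
    intro j; rw [h]; split_ifs <;> ring
  simp only [this, Finset.sum_add_distrib, Finset.sum_sub_distrib, ← Finset.mul_sum, hx, adjLin_apply]
  simp

theorem T_norm {n d : ℕ} {A : Matrix (Fin n) (Fin n) ℝ} {a b : ℝ}
    {p : Fin n → EuclideanSpace ℝ (Fin d)}
    (h : ∀ i j, dist (p i) (p j) ^ 2 = b * (if i = j then 0 else 1) + a * A i j)
    (x : EuclideanSpace ℝ (Fin n)) (hx : phi n x = 0) :
    ‖Tmap p x‖ ^ 2 = (b * ‖x‖ ^ 2 - a * ⟪x, Matrix.toEuclideanLin A x⟫_ℝ) / 2 := by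
  have hx' := hx
  rw [phi_apply] at hx'
  rw [← real_inner_self_eq_norm_sq, Tmap_apply,
    inner_sum_smul_sum_smul_of_sum_eq_zero _ hx' _ hx']
  have : ∀ i, ∑ j, x i * x j * (‖p i - p j‖ * ‖p i - p j‖)
      = - b * (x i) ^ 2 + a * (x i * Matrix.toEuclideanLin A x i) := by
    intro i
    have := D_mul h x hx i
    rw [show - b * (x i) ^ 2 + a * (x i * Matrix.toEuclideanLin A x i)
      = x i * (- b * x i + a * Matrix.toEuclideanLin A x i) by ring, ← this, Finset.mul_sum]
    refine Finset.sum_congr rfl fun j _ => ?_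
    rw [dist_eq_norm]; ring
  simp only [this, Finset.sum_add_distrib, ← Finset.mul_sum]
  have e1 : ∑ i, x i * Matrix.toEuclideanLin A x i = ⟪x, Matrix.toEuclideanLin A x⟫_ℝ := by
    rw [PiLp.inner_apply]
    exact Finset.sum_congr rfl fun i _ => by simp [mul_comm]
  rw [e1, EuclideanSpace.real_norm_sq_eq]
  ring

theorem sph_ker {n d : ℕ} {A : Matrix (Fin n) (Fin n) ℝ} {a b : ℝ} (ha : 0 < a)
    {p : Fin n → EuclideanSpace ℝ (Fin d)}
    (h : ∀ i j, dist (p i) (p j) ^ 2 = b * (if i = j then 0 else 1) + a * A i j)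
    {c : EuclideanSpace ℝ (Fin d)} {r : ℝ} (hc : ∀ i, dist (p i) c = r)
    (x : EuclideanSpace ℝ (Fin n)) (hx : phi n x = 0) (hT : Tmap p x = 0) :
    Matrix.toEuclideanLin A x = (b / a) • x := by
  ext i
  have h0 : ∑ j, x j • (p j - c) = 0 := by
    simp only [smul_sub, Finset.sum_sub_distrib, ← Finset.sum_smul]
    rw [phi_apply] at hx
    rw [hx, ← Tmap_apply, hT]; simp
  have h1 : ∑ j, x j * ⟪p i - c, p j - c⟫_ℝ = 0 := by
    have : ⟪p i - c, ∑ j, x j • (p j - c)⟫_ℝ = 0 := by rw [h0, inner_zero_right]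
    simpa only [inner_sum, inner_smul_right] using this
  have h2 : ∀ j, x j * ⟪p i - c, p j - c⟫_ℝ = r ^ 2 * x j - (1/2) * (dist (p i) (p j) ^ 2 * x j) := by
    intro j
    rw [real_inner_eq_norm_mul_self_add_norm_mul_self_sub_norm_sub_mul_self_div_two,
      sub_sub_sub_cancel_right, ← dist_eq_norm, ← dist_eq_norm, ← dist_eq_norm, hc, hc]
    ring
  simp only [h2, Finset.sum_sub_distrib, ← Finset.mul_sum] at h1
  rw [D_mul h x hx, ← phi_apply, hx] at h1
  rw [PiLp.smul_apply, smul_eq_mul]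
  field_simp
  linarith

theorem finrank_domRestrict_ker {E F : Type*} [AddCommGroup E] [Module ℝ E] [AddCommGroup F]
    [Module ℝ F] (f : E →ₗ[ℝ] F) (U : Submodule ℝ E) :
    Module.finrank ℝ (LinearMap.ker (f.domRestrict U)) =
        Module.finrank ℝ ↥(U ⊓ LinearMap.ker f) := by
  have : (LinearMap.ker (f.domRestrict U)).map U.subtype = U ⊓ LinearMap.ker f := by
    ext x; simp [LinearMap.domRestrict_apply, and_comm]
  rw [← this, LinearEquiv.finrank_eq (Submodule.equivMapOfInjective _ U.injective_subtype _)]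

theorem finrank_ker_phi (n : ℕ) : Module.finrank ℝ (LinearMap.ker (phi (n+1))) = n := by
  have h : phi (n+1) ≠ 0 := by
    intro h
    have := congrArg (fun f => f (EuclideanSpace.single 0 1)) h
    simp [phi_apply, Finset.sum_ite_eq] at this
  have := Module.Dual.finrank_ker_add_one_of_ne_zero h
  simp at this
  exact this

theorem perron_s18 {n : ℕ} (G : SimpleGraph (Fin n)) [DecidableRel G.Adj]
    (v : EuclideanSpace ℝ (Fin n)) (hv : v ≠ 0) :
    ∃ u, ‖u‖ = ‖v‖ ∧ ⟪v, Matrix.toEuclideanLin (G.adjMatrix ℝ) v⟫_ℝ ≤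
      ⟪u, Matrix.toEuclideanLin (G.adjMatrix ℝ) u⟫_ℝ ∧ phi n u ≠ 0 := by
  refine ⟨WithLp.toLp 2 (fun i => |v i|), ?_, ?_, ?_⟩
  · rw [EuclideanSpace.norm_eq, EuclideanSpace.norm_eq]; simp
  · rw [inner_L, inner_L]
    refine Finset.sum_le_sum fun i _ => Finset.sum_le_sum fun j _ => ?_
    refine mul_le_mul_of_nonneg_right ?_ ?_
    · simpa [← abs_mul] using le_abs_self (v i * v j)
    · rw [SimpleGraph.adjMatrix_apply]; split_ifs <;> norm_num
  · intro h
    apply hv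
    rw [phi_apply, Finset.sum_eq_zero_iff_of_nonneg (fun i _ => abs_nonneg _)] at h
    ext i
    simpa using h i (Finset.mem_univ i)

/-- **Proposition 16.** Let `G` be a spherical graph on `n = N+3 ≥ 3` vertices
(spherically representable in `ℝ^{n-2}`), with sorted adjacency eigenvalues `μ`,
and let `K` be the largest index with `μ K = λ₂` (so that, in 1-based
numbering, `k = K + 1` is the largest index with `λ_k = λ₂`). Then the lowest
dimension in which `G` is representable is `n - k`. -/
theorem stmt18 (N : ℕ) (G : SimpleGraph (Fin (N+3))) [DecidableRel G.Adj]
    (hsph : Spherical (N+3) (N+1) G)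
    (hA : (G.adjMatrix ℝ).IsHermitian)
    (μ : Fin (N+3) → ℝ) (hmono : Antitone μ)
    (hperm : ∃ σ : Equiv.Perm (Fin (N+3)), μ = hA.eigenvalues ∘ σ)
    (K : Fin (N+3)) (hK : IsGreatest {i : Fin (N+3) | μ i = μ 1} K) :
    IsLeast {m : ℕ | ∃ k : ℝ, RepresentableWith (N+3) m G k}
      (N + 3 - ((K : ℕ) + 1)) := by
  obtain ⟨k, p, c, r, hp, hc⟩ := hsph
  obtain ⟨a, b, ha, hb, hD⟩ := rep_form hp
  obtain ⟨σ, hσ⟩ := hperm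
  set L := Matrix.toEuclideanLin (G.adjMatrix ℝ) with hLdef
  set φ := phi (N+3) with hφ
  set t := b / a with ht
  have hbt : b = t * a := by rw [ht]; field_simp
  have f1 : ∀ x, φ x = 0 → ‖Tmap p x‖ ^ 2 = a * (t * ‖x‖ ^ 2 - ⟪x, L x⟫_ℝ) / 2 := by
    intro x hx
    rw [T_norm hD x hx, ← hLdef]
    rw [hbt]; ring
  have h1 : ∀ x, φ x = 0 → ⟪x, L x⟫_ℝ ≤ t * ‖x‖ ^ 2 := by
    intro x hx
    have e := f1 x hx
    by_contra! hlt
    nlinarith [sq_nonneg ‖Tmap p x‖]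
  have hkT : ∀ x, φ x = 0 → ⟪x, L x⟫_ℝ = t * ‖x‖ ^ 2 → Tmap p x = 0 := by
    intro x hx hx2
    have e := f1 x hx
    rw [hx2] at e
    simpa using e
  have h2 : ∀ x, φ x = 0 → ⟪x, L x⟫_ℝ = t * ‖x‖ ^ 2 → L x = t • x := fun x hx hx2 =>
    sph_ker ha hD hc x hx (hkT x hx hx2)
  have hrn : ∀ (d : ℕ) (q : Fin (N+3) → EuclideanSpace ℝ (Fin d)),
      Module.finrank ℝ (LinearMap.range ((Tmap q).domRestrict (LinearMap.ker φ)))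
      + Module.finrank ℝ ↥(LinearMap.ker φ ⊓ LinearMap.ker (Tmap q)) = N + 2 := by
    intro d q
    rw [← finrank_domRestrict_ker, LinearMap.finrank_range_add_finrank_ker]
    exact finrank_ker_phi (N+2)
  have hZ : LinearMap.ker φ ⊓ LinearMap.ker (L - t • LinearMap.id)
      = LinearMap.ker φ ⊓ LinearMap.ker (Tmap p) := by
    ext x
    simp only [Submodule.mem_inf, LinearMap.mem_ker, LinearMap.sub_apply, LinearMap.smul_apply,
      LinearMap.id_apply, sub_eq_zero]
    constructor
    · rintro ⟨hx, hx2⟩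
      refine ⟨hx, hkT x hx ?_⟩
      rw [hx2, inner_smul_right, real_inner_self_eq_norm_sq]
    · rintro ⟨hx, hx2⟩
      exact ⟨hx, sph_ker ha hD hc x hx hx2⟩
  have hrk := hrn _ p
  rw [← hZ] at hrk
  set Z := LinearMap.ker φ ⊓ LinearMap.ker (L - t • LinearMap.id) with hZdef
  have hZmem : ∀ x ∈ Z, φ x = 0 ∧ L x = t • x := by
    intro x hx
    simpa only [hZdef, Submodule.mem_inf, LinearMap.mem_ker, LinearMap.sub_apply,
      LinearMap.smul_apply, LinearMap.id_apply, sub_eq_zero] using hx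
  have hd1 : 1 ≤ Module.finrank ℝ Z := by
    have := Submodule.finrank_le (LinearMap.range ((Tmap p).domRestrict (LinearMap.ker φ)))
    rw [finrank_euclideanSpace_fin] at this
    omega
  obtain ⟨z, hz0, hzφ, hzL⟩ : ∃ x, x ≠ 0 ∧ φ x = 0 ∧ L x = t • x := by
    obtain ⟨⟨z, hz⟩, hz0⟩ := (Module.finrank_pos_iff_exists_ne_zero (R := ℝ) (M := Z)).1 hd1
    exact ⟨z, fun h => hz0 (Subtype.ext h), hZmem z hz⟩
  obtain ⟨c1, c2⟩ := core hA.eigenvectorBasis L hA.eigenvalues (by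
      intro i
      ext j
      have := congrFun (hA.mulVec_eigenvectorBasis i) j
      rw [hLdef, Matrix.ofLp_toEuclideanLin_apply, this]; rfl)
    φ t h1 h2 ⟨z, hz0, hzφ, hzL⟩ (perron_s18 G)
  have hKd : (K : ℕ) = Module.finrank ℝ Z := by
    refine sorted_count N μ hmono K hK t _ hd1 ?_ ?_
    · rw [← c1]
      refine Finset.card_bij (fun i _ => σ i) ?_ ?_ ?_
      · intro i hi; simpa [hσ] using hi
      · intro i _ j _ h; exact σ.injective h
      · intro j hj; exact ⟨σ.symm j, by simpa [hσ] using hj, by simp⟩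
    · refine le_trans (le_of_eq ?_) c2
      refine Finset.card_bij (fun i _ => σ i) ?_ ?_ ?_
      · intro i hi; simpa [hσ] using hi
      · intro i _ j _ h; exact σ.injective h
      · intro j hj; exact ⟨σ.symm j, by simpa [hσ] using hj, by simp⟩
  constructor
  · refine ⟨k, ?_⟩
    set R := LinearMap.range ((Tmap p).domRestrict (LinearMap.ker φ)) with hR
    have hfr : Module.finrank ℝ R = N + 3 - ((K : ℕ) + 1) := by omega
    have hmem : ∀ i, p i - p 0 ∈ R := by
      intro i
      refine ⟨⟨EuclideanSpace.single i 1 - EuclideanSpace.single 0 1, ?_⟩, ?_⟩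
      · rw [LinearMap.mem_ker, map_sub, hφ, phi_apply, phi_apply]
        simp
      · rw [LinearMap.domRestrict_apply, map_sub, Tmap_apply, Tmap_apply]
        simp [ite_smul]
    let e := (stdOrthonormalBasis ℝ R).reindex (finCongr hfr)
    refine ⟨fun i => e.repr ⟨p i - p 0, hmem i⟩, ?_⟩
    have hdist : ∀ i j, dist (e.repr ⟨p i - p 0, hmem i⟩) (e.repr ⟨p j - p 0, hmem j⟩)
        = dist (p i) (p j) := by
      intro i j
      rw [LinearIsometryEquiv.dist_map, Subtype.dist_eq, dist_sub_right]
    obtain ⟨α₁, α₂, q1, q2, q3, q4, q5, q6⟩ := hp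
    refine ⟨α₁, α₂, q1, q2, q3, ?_, ?_, q6⟩
    · intro i j h; rw [hdist]; exact q4 i j h
    · intro i j h h'; rw [hdist]; exact q5 i j h h'
  · rintro m ⟨k', q, hq⟩
    obtain ⟨a', b', ha', hb', hD'⟩ := rep_form hq
    have hbig : t * a' ≤ b' := by
      have e := T_norm hD' z hzφ
      rw [← hLdef, hzL, inner_smul_right, real_inner_self_eq_norm_sq] at e
      have hz : 0 < ‖z‖ ^ 2 := by positivity
      by_contra! hlt
      nlinarith [sq_nonneg ‖Tmap q z‖, mul_pos hz (sub_pos.2 hlt)]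
    have hle : LinearMap.ker φ ⊓ LinearMap.ker (Tmap q) ≤ Z := by
      rw [hZ]
      rintro x ⟨hx1, hx2⟩
      refine ⟨hx1, ?_⟩
      have hx1 : φ x = 0 := hx1
      have hx2 : Tmap q x = 0 := hx2
      have e := T_norm hD' x hx1
      rw [← hLdef, hx2, norm_zero] at e
      refine hkT x hx1 (le_antisymm (h1 x hx1) ?_)
      have := mul_le_mul_of_nonneg_right hbig (sq_nonneg ‖x‖)
      by_contra! hlt
      nlinarith [mul_pos ha' (sub_pos.2 hlt)]
    have f3 := Submodule.finrank_mono hle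
    have f4 := hrn _ q
    have f5 := Submodule.finrank_le (LinearMap.range ((Tmap q).domRestrict (LinearMap.ker φ)))
    rw [finrank_euclideanSpace_fin] at f5
    omega
end
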